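/- arXiv:2410.17649 — 3 statements merged into one kernel-verified Lean document; each statement's English description precedes it below -/
import Mathlib

section
/- Convergence of denoising functionals under time mollification: Let Ω ⊂ ℝ^N be a bounded open set, 0 < T < ∞, and let S : Ω×ℝ → ℝ be a Carathéodory integrand such that for a.e. x ∈ Ω the map u ↦ S(x,u) is convex and nonnegative. Assume v ∈ L^1(Ω×(0,T)) with S(·,v) ∈ L^1(Ω×(0,T)), v_0 ∈ L^1(Ω) with S(·,v_0) ∈ L^1(Ω). Then for every 0 < h ≤ T the time mollification satisfies S(·,[v]_h) ∈ L^1(Ω×(0,T)), and lim_{h→0} ∫_0^T ∫_Ω S(x,[v]_h(x,t)) dx dt = ∫_0^T ∫_Ω S(x,v(x,t)) dx dt. -/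
noncomputable section

open MeasureTheory Set Filter ENNReal
open scoped Topology

/-- Euclidean space `ℝ^N`. -/
abbrev Euc (N : ℕ) : Type := EuclideanSpace ℝ (Fin N)

/-- The product measure on the parabolic cylinder `Ω × (0,T)`. -/
def parMeas (N : ℕ) (Ω : Set (Euc N)) (T : ℝ) : Measure (ℝ × Euc N) :=
  (volume.restrict (Ioo 0 T)).prod (volume.restrict Ω)

/-- The pointwise-in-space time mollification
`[v]_h(t)(x) = e^{-t/h} v₀(x) + (1/h) ∫_0^t e^{(s-t)/h} v(s)(x) ds`. -/
def timeMollFun (N : ℕ) (v0 : Euc N → ℝ) (v : ℝ → Euc N → ℝ) (h t : ℝ) (x : Euc N) : ℝ :=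
  Real.exp (-t / h) * v0 x + (1 / h) * ∫ s in Ioo (0:ℝ) t, Real.exp ((s - t) / h) * v s x


lemma hasDerivAt_e (t h s : ℝ) : HasDerivAt (fun s => Real.exp ((s - t) / h)) (Real.exp ((s - t) / h) * (1 / h)) s := by
  exact (((hasDerivAt_id s).sub_const t).div_const h).exp

lemma int_e (t h : ℝ) (hh : h ≠ 0) :
    ∫ s in (0:ℝ)..t, Real.exp ((s - t) / h) = h * (1 - Real.exp (-t / h)) := by
  rw [intervalIntegral.integral_eq_sub_of_hasDerivAt (f := fun s => h * Real.exp ((s - t) / h))]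
  · simp; ring
  · intro s _
    have := (hasDerivAt_e t h s).const_mul h
    refine HasDerivAt.congr_deriv this ?_
    field_simp
  · exact Continuous.intervalIntegrable (by fun_prop) _ _

lemma int_e1 (t h : ℝ) (hh : h ≠ 0) :
    ∫ s in (0:ℝ)..t, Real.exp ((s - t) / h) * (t - s) = h ^ 2 * (1 - Real.exp (-t / h) * (t / h + 1)) := by
  rw [intervalIntegral.integral_eq_sub_of_hasDerivAt
    (f := fun s => h ^ 2 * (Real.exp ((s - t) / h) * ((t - s) / h + 1)))]
  · simp; ring
  · intro s _
    have h1 : HasDerivAt (fun s => (t - s) / h + 1) (-1 / h) s :=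
      (((hasDerivAt_id s).const_sub t).div_const h).add_const 1
    have := ((hasDerivAt_e t h s).mul h1).const_mul (h ^ 2)
    refine HasDerivAt.congr_deriv this ?_
    field_simp
    ring
  · exact Continuous.intervalIntegrable (by fun_prop) _ _

lemma ibp_e (f : ℝ → ℝ) (t h : ℝ) (hf : IntervalIntegrable f volume 0 t) :
    ∫ s in (0:ℝ)..t, Real.exp ((s - t) / h) * f s = (∫ s in (0:ℝ)..t, f s)
      - (1 / h) * ∫ s in (0:ℝ)..t, Real.exp ((s - t) / h) * ∫ r in (0:ℝ)..s, f r := by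
  have hac := hf.absolutelyContinuousOnInterval_intervalIntegral (c := 0) (by simp)
  have hl : AbsolutelyContinuousOnInterval (fun s => Real.exp ((s - t) / h)) 0 t := by
    have hc : ContDiff ℝ 1 (fun s => Real.exp ((s - t) / h)) := by fun_prop
    have hc' := (hc.contDiffOn (s := uIcc 0 t)).exists_lipschitzOnWith one_ne_zero (convex_uIcc 0 t) isCompact_uIcc
    obtain ⟨K, hK⟩ := hc'
    exact hK.absolutelyContinuousOnInterval
  have key := hl.integral_mul_deriv_eq_deriv_mul hac
  have e1 : ∫ s in (0:ℝ)..t, Real.exp ((s - t) / h) * f s =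
      ∫ s in (0:ℝ)..t, Real.exp ((s - t) / h) * deriv (fun x => ∫ v in (0:ℝ)..x, f v) s := by
    apply intervalIntegral.integral_congr_ae
    filter_upwards [hf.ae_hasDerivAt_integral] with s hs hs'
    rw [(hs (uIoc_subset_uIcc hs') 0 (by simp)).deriv]
  rw [e1, key]
  simp only [(hasDerivAt_e t h _).deriv, sub_self, zero_div, Real.exp_zero, one_mul,
    intervalIntegral.integral_same, mul_zero, sub_zero]
  congr 1
  rw [← intervalIntegral.integral_const_mul]
  apply intervalIntegral.integral_congr
  intro s _
  simp; ring

lemma rem_tendsto (R : ℝ → ℝ) (t : ℝ) (ht : 0 < t) (hc : ContinuousOn R (Icc 0 t))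
    (hR : ∀ ε > 0, ∃ δ > 0, ∀ s ∈ Icc 0 t, t - s < δ → |R s| ≤ ε * (t - s)) :
    Tendsto (fun h : ℝ => (1 / h ^ 2) * ∫ s in (0:ℝ)..t, Real.exp ((s - t) / h) * R s)
      (𝓝[>] 0) (𝓝 0) := by
  obtain ⟨M, hM⟩ := isCompact_Icc.exists_bound_of_continuousOn hc
  have hM0 : 0 ≤ M := (norm_nonneg _).trans (hM 0 ⟨le_rfl, ht.le⟩)
  rw [Metric.tendsto_nhdsWithin_nhds]
  intro ε hε
  obtain ⟨δ, hδ, hRδ⟩ := hR (ε / 2) (by positivity)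
  set C := M / δ ^ 3 with hC
  have hC0 : 0 ≤ C := by positivity
  refine ⟨ε / 2 / (6 * C * t + 1), by positivity, fun h hh hhd => ?_⟩
  have hh : 0 < h := hh
  have hhd : h * (6 * C * t + 1) < ε / 2 := by
    rw [Real.dist_eq, sub_zero, abs_of_pos hh, lt_div_iff₀ (by positivity)] at hhd
    exact hhd
  rw [dist_zero_right]
  have hb : ∀ s ∈ Icc 0 t, ‖Real.exp ((s - t) / h) * R s‖ ≤
      ε / 2 * (Real.exp ((s - t) / h) * (t - s)) + C * 6 * h ^ 3 := by
    intro s hs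
    have hu : 0 ≤ t - s := sub_nonneg.2 hs.2
    have hexp : Real.exp ((s - t) / h) * (t - s) ^ 3 ≤ 6 * h ^ 3 := by
      have := Real.pow_div_factorial_le_exp ((t - s) / h) (by positivity) 3
      have h2 : Real.exp ((s - t) / h) * Real.exp ((t - s) / h) = 1 := by
        rw [← Real.exp_add, ← Real.exp_zero]; congr 1; ring
      have h3 := mul_le_mul_of_nonneg_left this (Real.exp_pos ((s - t) / h)).le
      rw [h2] at h3
      simp [Nat.factorial] at h3
      have h4 : Real.exp ((s - t) / h) * (t - s) ^ 3 = (Real.exp ((s - t) / h) * (((t - s) / h) ^ 3 / 6)) * (6 * h ^ 3) := by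
        field_simp
      rw [h4]
      calc _ ≤ 1 * (6 * h ^ 3) := by gcongr
        _ = _ := one_mul _
    have hR' : |R s| ≤ ε / 2 * (t - s) + C * (t - s) ^ 3 := by
      by_cases hd : t - s < δ
      · exact (hRδ s hs hd).trans (le_add_of_nonneg_right (by positivity))
      · refine (hM s hs).trans ?_
        have : M ≤ C * (t - s) ^ 3 := by
          rw [hC, div_mul_eq_mul_div, le_div_iff₀ (by positivity)]
          gcongr
          linarith
        have : 0 ≤ ε / 2 * (t - s) := by positivity
        linarith
    rw [norm_mul, Real.norm_eq_abs, Real.norm_eq_abs, abs_of_pos (Real.exp_pos _)]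
    calc _ ≤ Real.exp ((s - t) / h) * (ε / 2 * (t - s) + C * (t - s) ^ 3) := by gcongr
      _ = ε / 2 * (Real.exp ((s - t) / h) * (t - s)) + C * (Real.exp ((s - t) / h) * (t - s) ^ 3) := by ring
      _ ≤ ε / 2 * (Real.exp ((s - t) / h) * (t - s)) + C * (6 * h ^ 3) := by gcongr
      _ = _ := by ring
  have hi := intervalIntegral.norm_integral_le_of_norm_le (μ := volume) (f := fun s => Real.exp ((s - t) / h) * R s) ht.le
    (ae_of_all _ fun s hs => hb s (Ioc_subset_Icc_self hs))
    (Continuous.intervalIntegrable (by fun_prop) _ _)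
  rw [intervalIntegral.integral_add (Continuous.intervalIntegrable (by fun_prop) _ _)
    (Continuous.intervalIntegrable (by fun_prop) _ _), intervalIntegral.integral_const_mul,
    int_e1 t h hh.ne', intervalIntegral.integral_const] at hi
  rw [norm_mul, Real.norm_of_nonneg (by positivity)]
  calc _ ≤ 1 / h ^ 2 * (ε / 2 * (h ^ 2 * (1 - Real.exp (-t / h) * (t / h + 1))) + (t - 0) • (C * 6 * h ^ 3)) := by gcongr
    _ = ε / 2 * (1 - Real.exp (-t / h) * (t / h + 1)) + 6 * C * t * h := by
      simp; field_simp
    _ ≤ ε / 2 * 1 + 6 * C * t * h := by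
      gcongr
      have : 0 ≤ Real.exp (-t / h) * (t / h + 1) := by positivity
      linarith
    _ < ε := by nlinarith

lemma exp_small (t : ℝ) (ht : 0 < t) :
    Tendsto (fun h : ℝ => Real.exp (-t / h)) (𝓝[>] 0) (𝓝 0) ∧
    Tendsto (fun h : ℝ => Real.exp (-t / h) * (1 / h)) (𝓝[>] 0) (𝓝 0) := by
  constructor
  · have := (Real.tendsto_exp_neg_atTop_nhds_zero.comp
      ((tendsto_id.const_mul_atTop ht).comp tendsto_inv_nhdsGT_zero))
    refine this.congr fun h => ?_
    simp [div_eq_mul_inv]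
  · have h1 := Real.tendsto_pow_mul_exp_neg_atTop_nhds_zero 1
    have := (h1.comp
      ((tendsto_id.const_mul_atTop ht).comp tendsto_inv_nhdsGT_zero)).const_mul (1 / t)
    rw [mul_zero] at this
    refine this.congr fun h => ?_
    simp [div_eq_mul_inv]
    field_simp

lemma moll_tendsto (f : ℝ → ℝ) (a T : ℝ) (hT : 0 < T) (hf : IntegrableOn f (Ioo 0 T)) :
    ∀ᵐ t ∂(volume.restrict (Ioo 0 T)), Tendsto (fun h : ℝ => Real.exp (-t / h) * a +
      (1 / h) * ∫ s in Ioo (0:ℝ) t, Real.exp ((s - t) / h) * f s) (𝓝[>] 0) (𝓝 (f t)) := by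
  have hfi : IntervalIntegrable f volume 0 T := by
    rwa [intervalIntegrable_iff_integrableOn_Ioo_of_le hT.le]
  rw [ae_restrict_iff' measurableSet_Ioo]
  filter_upwards [hfi.ae_hasDerivAt_integral] with t hd ht
  have hd := hd (by rw [uIcc_of_le hT.le]; exact Ioo_subset_Icc_self ht) 0 (by simp)
  have hft : IntervalIntegrable f volume 0 t :=
    hfi.mono_set (by rw [uIcc_of_le hT.le, uIcc_of_le ht.1.le]; exact Icc_subset_Icc_right ht.2.le)
  set Φ := fun y => ∫ r in (0:ℝ)..y, f r with hΦ
  have hΦc : ContinuousOn Φ (Icc 0 t) := by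
    have := intervalIntegral.continuousOn_primitive_interval' hft (a := 0) (by simp)
    rwa [uIcc_of_le ht.1.le] at this
  have hrem := rem_tendsto (fun s => Φ s - Φ t - f t * (s - t)) t ht.1
    ((hΦc.sub continuousOn_const).sub (by fun_prop)) (by
      intro ε hε
      have := (hasDerivAt_iff_isLittleO.1 hd).def hε
      rw [Metric.eventually_nhds_iff] at this
      obtain ⟨δ, hδ, h⟩ := this
      refine ⟨δ, hδ, fun s hs hsd => ?_⟩
      have h1 : dist s t = t - s := by
        rw [dist_comm, Real.dist_eq, abs_of_nonneg (sub_nonneg.2 hs.2)]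
      have := h (h1.trans_lt hsd)
      rw [← dist_eq_norm s t, h1] at this
      simpa [mul_comm] using this)
  obtain ⟨E1, E2⟩ := exp_small t ht.1
  have lim := ((E1.mul_const a).add (E2.mul_const (Φ t))).add
    (((tendsto_const_nhds (x := (1:ℝ))).sub ((E2.mul_const t).add E1)).const_mul (f t)) |>.sub hrem
  simp only [zero_mul, add_zero, sub_zero, mul_one, zero_add] at lim
  refine lim.congr' ?_
  filter_upwards [self_mem_nhdsWithin] with h hh
  have hh : 0 < h := hh
  rw [← integral_Ioc_eq_integral_Ioo, ← intervalIntegral.integral_of_le ht.1.le, ibp_e f t h hft]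
  have hdec : ∫ s in (0:ℝ)..t, Real.exp ((s - t) / h) * Φ s =
      (∫ s in (0:ℝ)..t, Real.exp ((s - t) / h) * (Φ s - Φ t - f t * (s - t))) +
      Φ t * (∫ s in (0:ℝ)..t, Real.exp ((s - t) / h))
      - f t * ∫ s in (0:ℝ)..t, Real.exp ((s - t) / h) * (t - s) := by
    rw [← intervalIntegral.integral_const_mul, ← intervalIntegral.integral_const_mul,
      ← intervalIntegral.integral_add, ← intervalIntegral.integral_sub]
    · apply intervalIntegral.integral_congr
      intro s _
      simp; ring
    · refine IntervalIntegrable.add ?_ (Continuous.intervalIntegrable (by fun_prop) _ _)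
      apply ContinuousOn.intervalIntegrable
      rw [uIcc_of_le ht.1.le]
      fun_prop
    · exact (Continuous.intervalIntegrable (by fun_prop) _ _)
    · apply ContinuousOn.intervalIntegrable
      rw [uIcc_of_le ht.1.le]
      fun_prop
    · exact (Continuous.intervalIntegrable (by fun_prop) _ _)
  rw [hdec, int_e t h hh.ne', int_e1 t h hh.ne']
  field_simp
  ring

lemma jensen_moll (φ : ℝ → ℝ) (hφ : ConvexOn ℝ univ φ) (f : ℝ → ℝ) (a t h : ℝ) (ht : 0 < t) (hh : 0 < h)
    (hf : IntegrableOn f (Ioo 0 t)) (hφf : IntegrableOn (fun s => φ (f s)) (Ioo 0 t)) :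
    φ (Real.exp (-t / h) * a + (1 / h) * ∫ s in Ioo (0:ℝ) t, Real.exp ((s - t) / h) * f s) ≤
     Real.exp (-t / h) * φ a + (1 / h) * ∫ s in Ioo (0:ℝ) t, Real.exp ((s - t) / h) * φ (f s) := by
  set m := Real.exp (-t / h) * a + (1 / h) * ∫ s in Ioo (0:ℝ) t, Real.exp ((s - t) / h) * f s with hm
  obtain ⟨c, hc⟩ : ∃ c, ∀ y, φ m + c * (y - m) ≤ φ y := by
    refine ⟨derivWithin φ (Ioi m) m, fun y => ?_⟩
    rcases lt_trichotomy m y with hy | hy | hy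
    · have := hφ.rightDeriv_le_slope_of_mem_interior (x := m) (by simp) (mem_univ y) hy
      rw [slope_def_field, le_div_iff₀ (by linarith)] at this
      linarith
    · simp [hy]
    · have := (hφ.slope_le_leftDeriv_of_mem_interior (y := m) (mem_univ y) (by simp) hy).trans
        (hφ.leftDeriv_le_rightDeriv_of_mem_interior (by simp))
      rw [slope_def_field, div_le_iff₀ (by linarith)] at this
      linarith
  have hmul : ∀ g : ℝ → ℝ, IntegrableOn g (Ioo 0 t) →
      IntegrableOn (fun s => Real.exp ((s - t) / h) * g s) (Ioo 0 t) := by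
    intro g hg
    rw [← integrableOn_Icc_iff_integrableOn_Ioo] at hg ⊢
    exact hg.continuousOn_mul (by fun_prop) isCompact_Icc
  have hone : IntegrableOn (fun s => Real.exp ((s - t) / h)) (Ioo 0 t) := by
    rw [← integrableOn_Icc_iff_integrableOn_Ioo]
    exact ContinuousOn.integrableOn_Icc (by fun_prop)
  have hI : ∫ s in Ioo (0:ℝ) t, Real.exp ((s - t) / h) = h * (1 - Real.exp (-t / h)) := by
    rw [← integral_Ioc_eq_integral_Ioo, ← intervalIntegral.integral_of_le ht.le, int_e t h hh.ne']
  have h1 : ∫ s in Ioo (0:ℝ) t, ((φ m - c * m) * Real.exp ((s - t) / h) + c * (Real.exp ((s - t) / h) * f s))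
      ≤ ∫ s in Ioo (0:ℝ) t, Real.exp ((s - t) / h) * φ (f s) := by
    apply integral_mono ((hone.const_mul _).add ((hmul f hf).const_mul _)) (hmul _ hφf)
    intro s
    have := mul_le_mul_of_nonneg_left (hc (f s)) (Real.exp_pos ((s - t) / h)).le
    simp only [Pi.add_apply]
    linarith
  rw [integral_add (hone.const_mul _) ((hmul f hf).const_mul _), integral_const_mul, integral_const_mul, hI] at h1
  have h2 := mul_le_mul_of_nonneg_left (hc a) (Real.exp_pos (-t / h)).le
  have h3 := mul_le_mul_of_nonneg_left h1 (by positivity : 0 ≤ 1 / h)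
  have h4 : 1 / h * ((φ m - c * m) * (h * (1 - Real.exp (-t / h)))
     + c * ∫ s in Ioo (0:ℝ) t, Real.exp ((s - t) / h) * f s) = (φ m - c * m) * (1 - Real.exp (-t / h)) + c * (m - Real.exp (-t / h) * a) := by
    rw [hm]; field_simp; ring
  rw [h4] at h3
  linarith

lemma kernel_le (s T h : ℝ) (hh : 0 < h) :
    ∫⁻ t in Ioc s T, ENNReal.ofReal ((1 / h) * Real.exp ((s - t) / h)) ≤ 1 := by
  rcases lt_or_ge T s with hs | hs
  · simp [Ioc_eq_empty_of_le hs.le]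
  have hint : IntegrableOn (fun t => (1 / h) * Real.exp ((s - t) / h)) (Ioc s T) :=
    (Continuous.integrableOn_Ioc (by fun_prop))
  rw [← ofReal_integral_eq_lintegral_ofReal hint (ae_of_all _ fun t => by positivity),
    ← intervalIntegral.integral_of_le hs,
    intervalIntegral.integral_eq_sub_of_hasDerivAt (f := fun t => - Real.exp ((s - t) / h))]
  · rw [ENNReal.ofReal_le_one]
    have := Real.exp_pos ((s - T) / h)
    simp
    exact this.le
  · intro t _
    have := (((hasDerivAt_id t).const_sub s).div_const h).exp.neg
    refine HasDerivAt.congr_deriv this ?_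
    simp; ring
  · exact Continuous.intervalIntegrable (by fun_prop) _ _

lemma tonelli_moll (g : ℝ → ℝ≥0∞) (hg : Measurable g) (T h : ℝ) (hh : 0 < h) :
    ∫⁻ t in Ioo 0 T, ∫⁻ s in Ioo 0 t, ENNReal.ofReal ((1 / h) * Real.exp ((s - t) / h)) * g s
      ≤ ∫⁻ s in Ioo 0 T, g s := by
  set K : ℝ → ℝ → ℝ≥0∞ := fun t s => (Ioi s).indicator
    (fun t => ENNReal.ofReal ((1 / h) * Real.exp ((s - t) / h))) t with hK
  have hKm : Measurable (Function.uncurry K) := by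
    have : Function.uncurry K = {p : ℝ × ℝ | p.2 < p.1}.indicator
        (fun p => ENNReal.ofReal ((1 / h) * Real.exp ((p.2 - p.1) / h))) := by
      ext p
      simp [hK, Function.uncurry, indicator]
    rw [this]
    refine Measurable.indicator (by fun_prop) (measurableSet_lt measurable_snd measurable_fst)
  calc _ ≤ ∫⁻ t in Ioo 0 T, ∫⁻ s in Ioo 0 T, K t s * g s := by
        refine setLIntegral_mono' measurableSet_Ioo fun t ht => ?_
        calc _ = ∫⁻ s in Ioo 0 t, K t s * g s := by
              refine setLIntegral_congr_fun measurableSet_Ioo fun s hs => ?_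
              simp [hK, hs.2]
          _ ≤ _ := lintegral_mono_set (Ioo_subset_Ioo_right ht.2.le)
    _ = ∫⁻ s in Ioo 0 T, ∫⁻ t in Ioo 0 T, K t s * g s := by
        refine lintegral_lintegral_swap ?_
        exact (hKm.mul (hg.comp measurable_snd)).aemeasurable
    _ ≤ ∫⁻ s in Ioo 0 T, g s := by
        refine lintegral_mono fun s => ?_
        have hKs : Measurable fun t => K t s :=
          hKm.comp (measurable_id.prodMk measurable_const)
        rw [lintegral_mul_const _ hKs]
        have : ∫⁻ t in Ioo 0 T, K t s ≤ 1 := by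
          simp only [hK]
          rw [setLIntegral_indicator measurableSet_Ioi]
          refine le_trans (lintegral_mono_set ?_) (kernel_le s T h hh)
          intro t ht
          exact ⟨ht.1, ht.2.2.le⟩
        calc _ ≤ 1 * g s := by gcongr
          _ = _ := one_mul _

lemma bound_1d (φ : ℝ → ℝ) (hφ : ConvexOn ℝ univ φ) (hφ0 : ∀ r, 0 ≤ φ r) (hφc : Continuous φ)
    (f : ℝ → ℝ) (hfm : Measurable f) (a T h : ℝ) (hh : 0 < h)
    (hf : IntegrableOn f (Ioo 0 T)) (hφf : IntegrableOn (fun s => φ (f s)) (Ioo 0 T)) :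
    ∫⁻ t in Ioo 0 T, ENNReal.ofReal (φ (Real.exp (-t / h) * a +
        (1 / h) * ∫ s in Ioo (0:ℝ) t, Real.exp ((s - t) / h) * f s)) ≤
      ENNReal.ofReal h * ENNReal.ofReal (φ a) + ∫⁻ s in Ioo 0 T, ENNReal.ofReal (φ (f s)) := by
  have hg : Measurable fun s => ENNReal.ofReal (φ (f s)) :=
    (hφc.measurable.comp hfm).ennreal_ofReal
  calc _ ≤ ∫⁻ t in Ioo 0 T, (ENNReal.ofReal (Real.exp (-t / h)) * ENNReal.ofReal (φ a) +
        ∫⁻ s in Ioo 0 t, ENNReal.ofReal ((1 / h) * Real.exp ((s - t) / h)) *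
          ENNReal.ofReal (φ (f s))) := by
        refine setLIntegral_mono' measurableSet_Ioo fun t ht => ?_
        have hs : Ioo 0 t ⊆ Ioo 0 T := Ioo_subset_Ioo_right ht.2.le
        have hj := jensen_moll φ hφ f a t h ht.1 hh (hf.mono_set hs) (hφf.mono_set hs)
        have hmul : IntegrableOn (fun s => (1 / h) * Real.exp ((s - t) / h) * φ (f s)) (Ioo 0 t) := by
          have hg := hφf.mono_set hs
          rw [← integrableOn_Icc_iff_integrableOn_Ioo] at hg ⊢
          exact hg.continuousOn_mul (by fun_prop) isCompact_Icc
        refine (ENNReal.ofReal_le_ofReal hj).trans ?_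
        refine ENNReal.ofReal_add_le.trans ?_
        refine add_le_add (ENNReal.ofReal_mul (by positivity)).le ?_
        rw [← integral_const_mul]
        simp only [← mul_assoc]
        rw [ofReal_integral_eq_lintegral_ofReal hmul
          (ae_of_all _ fun s => mul_nonneg (by positivity) (hφ0 _))]
        refine lintegral_mono fun s => ?_
        exact (ENNReal.ofReal_mul (by positivity)).le
    _ = (∫⁻ t in Ioo 0 T, ENNReal.ofReal (Real.exp (-t / h)) * ENNReal.ofReal (φ a)) +
        ∫⁻ t in Ioo 0 T, ∫⁻ s in Ioo 0 t, ENNReal.ofReal ((1 / h) * Real.exp ((s - t) / h)) *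
          ENNReal.ofReal (φ (f s)) := by
        refine lintegral_add_left (by fun_prop) _
    _ ≤ _ := by
        refine add_le_add ?_ (tonelli_moll _ hg T h hh)
        rw [lintegral_mul_const _ (by fun_prop)]
        gcongr
        calc _ ≤ ∫⁻ t in Ioc 0 T, ENNReal.ofReal (Real.exp (-t / h)) :=
              lintegral_mono_set Ioo_subset_Ioc_self
          _ = ∫⁻ t in Ioc 0 T, ENNReal.ofReal h * ENNReal.ofReal ((1 / h) * Real.exp ((0 - t) / h)) := by
              refine lintegral_congr fun t => ?_
              rw [← ENNReal.ofReal_mul hh.le]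
              congr 1
              field_simp
              simp [neg_div]
          _ ≤ ENNReal.ofReal h * 1 := by
              rw [lintegral_const_mul _ (by fun_prop)]
              gcongr
              exact kernel_le 0 T h hh
          _ = _ := mul_one _

lemma measurable_moll (N : ℕ) (v0 : Euc N → ℝ) (v : ℝ → Euc N → ℝ) (h : ℝ)
    (hvm : Measurable (fun p : ℝ × Euc N => v p.1 p.2)) (hv0m : Measurable v0) :
    Measurable (fun p : ℝ × Euc N => timeMollFun N v0 v h p.1 p.2) := by
  unfold timeMollFun
  refine Measurable.add (by fun_prop) (Measurable.const_mul ?_ _)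
  have hF : StronglyMeasurable (fun q : (ℝ × Euc N) × ℝ =>
      {q : (ℝ × Euc N) × ℝ | 0 < q.2 ∧ q.2 < q.1.1}.indicator
        (fun q => Real.exp ((q.2 - q.1.1) / h) * v q.2 q.1.2) q) := by
    refine Measurable.stronglyMeasurable ?_
    refine Measurable.indicator ?_ ?_
    · refine Measurable.mul (by fun_prop) ?_
      exact hvm.comp (measurable_snd.prodMk (measurable_snd.comp measurable_fst))
    · exact (measurableSet_lt measurable_const measurable_snd).inter
        (measurableSet_lt measurable_snd (measurable_fst.comp measurable_fst))
  have := (hF.integral_prod_right' (ν := (volume : Measure ℝ))).measurable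
  convert this using 2 with p
  rw [← integral_indicator measurableSet_Ioo]
  congr 1

/-- The measurable case. -/
lemma denoising_core
    (N : ℕ) (Ω : Set (Euc N)) (T : ℝ) (hT : 0 < T)
    (S : Euc N → ℝ → ℝ)
    (hSmeas : ∀ r : ℝ, Measurable fun x => S x r)
    (hScont : ∀ x, Continuous fun r => S x r)
    (hSconv : ∀ᵐ x ∂(volume.restrict Ω),
      ConvexOn ℝ univ (fun r => S x r) ∧ ∀ r : ℝ, 0 ≤ S x r)
    (v : ℝ → Euc N → ℝ) (hvm : Measurable (fun p : ℝ × Euc N => v p.1 p.2))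
    (hv : Integrable (fun p : ℝ × Euc N => v p.1 p.2) (parMeas N Ω T))
    (hSv : Integrable (fun p : ℝ × Euc N => S p.2 (v p.1 p.2)) (parMeas N Ω T))
    (v0 : Euc N → ℝ) (hv0m : Measurable v0)
    (hSv0 : Integrable (fun x => S x (v0 x)) (volume.restrict Ω)) :
    (∀ h ∈ Ioc (0:ℝ) T,
      Integrable (fun p : ℝ × Euc N => S p.2 (timeMollFun N v0 v h p.1 p.2))
        (parMeas N Ω T)) ∧
    Tendsto (fun h : ℝ =>
        ∫ p : ℝ × Euc N, S p.2 (timeMollFun N v0 v h p.1 p.2) ∂(parMeas N Ω T))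
      (𝓝[>] 0)
      (𝓝 (∫ p : ℝ × Euc N, S p.2 (v p.1 p.2) ∂(parMeas N Ω T))) := by
  unfold parMeas at *
  set μ := (volume : Measure (Euc N)).restrict Ω with hμ
  set ν := (volume : Measure ℝ).restrict (Ioo 0 T) with hν
  have hSm : Measurable (fun p : Euc N × ℝ => S p.1 p.2) := by
    have := measurable_uncurry_of_continuous_of_measurable (u := fun r x => S x r) hScont hSmeas
    exact this.comp measurable_swap
  have hMm := fun h => measurable_moll N v0 v h hvm hv0m
  have hSMm : ∀ h, Measurable (fun p : ℝ × Euc N => S p.2 (timeMollFun N v0 v h p.1 p.2)) :=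
    fun h => hSm.comp (measurable_snd.prodMk (hMm h))
  have hSvm : Measurable (fun p : ℝ × Euc N => S p.2 (v p.1 p.2)) :=
    hSm.comp (measurable_snd.prodMk hvm)
  have hpos : ∀ᵐ p ∂(ν.prod μ), ∀ r, 0 ≤ S p.2 r := by
    have := Measure.quasiMeasurePreserving_snd (μ := ν) (ν := μ) |>.ae hSconv
    filter_upwards [this] with p hp using hp.2
  have hae : ∀ᵐ x ∂μ, Integrable (fun t => v t x) ν ∧ Integrable (fun t => S x (v t x)) ν ∧
      ConvexOn ℝ univ (fun r => S x r) ∧ ∀ r : ℝ, 0 ≤ S x r := by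
    filter_upwards [hv.prod_left_ae, hSv.prod_left_ae, hSconv] with x h1 h2 h3
    exact ⟨h1, h2, h3⟩
  set L : ℝ → ℝ≥0∞ := fun h => ∫⁻ p, ENNReal.ofReal (S p.2 (timeMollFun N v0 v h p.1 p.2)) ∂(ν.prod μ) with hL
  set C : ℝ≥0∞ := ∫⁻ p, ENNReal.ofReal (S p.2 (v p.1 p.2)) ∂(ν.prod μ) with hC
  set C0 : ℝ≥0∞ := ∫⁻ x, ENNReal.ofReal (S x (v0 x)) ∂μ with hC0
  have hLs : ∀ h, L h = ∫⁻ x, ∫⁻ t, ENNReal.ofReal (S x (timeMollFun N v0 v h t x)) ∂ν ∂μ :=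
    fun h => lintegral_prod_symm' _ (hSMm h).ennreal_ofReal
  have hCs : C = ∫⁻ x, ∫⁻ t, ENNReal.ofReal (S x (v t x)) ∂ν ∂μ :=
    lintegral_prod_symm' _ hSvm.ennreal_ofReal
  have hCtop : C ≠ ∞ := by
    have := hSv.lintegral_lt_top
    exact this.ne
  have hC0top : C0 ≠ ∞ := hSv0.lintegral_lt_top.ne
  have hup : ∀ h, 0 < h → L h ≤ ENNReal.ofReal h * C0 + C := by
    intro h hh
    rw [hLs, hCs, hC0, ← lintegral_const_mul' _ _ ENNReal.ofReal_ne_top, ← lintegral_add_left']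
    · refine lintegral_mono_ae ?_
      filter_upwards [hae] with x hx
      exact bound_1d (fun r => S x r) hx.2.2.1 hx.2.2.2 (hScont x) (fun t => v t x)
        (hvm.comp (measurable_id.prodMk measurable_const)) (v0 x) T h hh hx.1 hx.2.1
    · exact ((hSm.comp (measurable_id.prodMk hv0m)).ennreal_ofReal.const_mul _).aemeasurable
  have hfin : ∀ h, 0 < h → L h ≠ ∞ := fun h hh =>
    ((hup h hh).trans_lt (ENNReal.add_lt_top.2
      ⟨ENNReal.mul_lt_top ENNReal.ofReal_lt_top hC0top.lt_top, hCtop.lt_top⟩)).ne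
  have hlow : C ≤ liminf L (𝓝[>] 0) := by
    have e : L = fun h => ∫⁻ x, ∫⁻ t, ENNReal.ofReal (S x (timeMollFun N v0 v h t x)) ∂ν ∂μ :=
      funext hLs
    rw [e, hCs]
    refine le_trans ?_ (lintegral_liminf_le fun h => (hSMm h).ennreal_ofReal.lintegral_prod_left')
    refine lintegral_mono_ae ?_
    filter_upwards [hae] with x hx
    refine le_trans ?_ (lintegral_liminf_le fun h =>
      (hSMm h).ennreal_ofReal.comp (measurable_id.prodMk measurable_const))
    refine lintegral_mono_ae ?_
    filter_upwards [moll_tendsto (fun t => v t x) (v0 x) T hT hx.1] with t ht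
    have := (ENNReal.continuous_ofReal.tendsto _).comp (((hScont x).tendsto _).comp ht)
    exact this.liminf_eq.ge
  have hlim : Tendsto L (𝓝[>] 0) (𝓝 C) := by
    have hupl : Tendsto (fun h : ℝ => ENNReal.ofReal h * C0 + C) (𝓝[>] 0) (𝓝 C) := by
      have h1 : Tendsto (fun h : ℝ => ENNReal.ofReal h) (𝓝[>] 0) (𝓝 0) := by
        have := (ENNReal.continuous_ofReal.tendsto 0).mono_left (nhdsWithin_le_nhds (s := Ioi 0))
        simpa using this
      have := (ENNReal.Tendsto.mul_const h1 (Or.inr hC0top)).add_const C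
      simpa using this
    refine tendsto_of_le_liminf_of_limsup_le hlow ?_
    refine (limsup_le_limsup ?_).trans hupl.limsup_eq.le
    filter_upwards [self_mem_nhdsWithin] with h hh using hup h hh
  refine ⟨fun h hh => ?_, ?_⟩
  · refine ⟨(hSMm h).aestronglyMeasurable, ?_⟩
    rw [hasFiniteIntegral_iff_ofReal]
    · exact (hfin h hh.1).lt_top
    · filter_upwards [hpos] with p hp using hp _
  · have e1 : ∀ h, ∫ p : ℝ × Euc N, S p.2 (timeMollFun N v0 v h p.1 p.2) ∂(ν.prod μ) = (L h).toReal := by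
      intro h
      refine integral_eq_lintegral_of_nonneg_ae ?_ (hSMm h).aestronglyMeasurable
      filter_upwards [hpos] with p hp using hp _
    have e2 : ∫ p : ℝ × Euc N, S p.2 (v p.1 p.2) ∂(ν.prod μ) = C.toReal := by
      refine integral_eq_lintegral_of_nonneg_ae ?_ hSvm.aestronglyMeasurable
      filter_upwards [hpos] with p hp using hp _
    simp only [e1, e2]
    exact (ENNReal.tendsto_toReal hCtop).comp hlim

/-- Convergence of denoising functionals under time mollification: for a nonnegative
convex Carathéodory integrand `S`, one has `S(·,[v]_h) ∈ L¹(Ω × (0,T))` and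
`∫∫ S(x,[v]_h(x,t)) → ∫∫ S(x,v(x,t))` as `h → 0⁺`. -/
theorem denoising_timeMoll_convergence
    (N : ℕ) (hN : 1 ≤ N) (Ω : Set (Euc N)) (hΩo : IsOpen Ω)
    (hΩb : Bornology.IsBounded Ω) (T : ℝ) (hT : 0 < T)
    (S : Euc N → ℝ → ℝ)
    (hSmeas : ∀ r : ℝ, Measurable fun x => S x r)
    (hScont : ∀ x, Continuous fun r => S x r)
    (hSconv : ∀ᵐ x ∂(volume.restrict Ω),
      ConvexOn ℝ univ (fun r => S x r) ∧ ∀ r : ℝ, 0 ≤ S x r)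
    (v : ℝ → Euc N → ℝ)
    (hv : Integrable (fun p : ℝ × Euc N => v p.1 p.2) (parMeas N Ω T))
    (hSv : Integrable (fun p : ℝ × Euc N => S p.2 (v p.1 p.2)) (parMeas N Ω T))
    (v0 : Euc N → ℝ) (hv0 : Integrable v0 (volume.restrict Ω))
    (hSv0 : Integrable (fun x => S x (v0 x)) (volume.restrict Ω)) :
    (∀ h ∈ Ioc (0:ℝ) T,
      Integrable (fun p : ℝ × Euc N => S p.2 (timeMollFun N v0 v h p.1 p.2))
        (parMeas N Ω T)) ∧
    Tendsto (fun h : ℝ =>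
        ∫ p : ℝ × Euc N, S p.2 (timeMollFun N v0 v h p.1 p.2) ∂(parMeas N Ω T))
      (𝓝[>] 0)
      (𝓝 (∫ p : ℝ × Euc N, S p.2 (v p.1 p.2) ∂(parMeas N Ω T))) := by
  obtain ⟨w, hwm, hw⟩ := hv.aestronglyMeasurable.aemeasurable
  obtain ⟨w0, hw0m, hw0⟩ := hv0.aestronglyMeasurable.aemeasurable
  have hmoll : ∀ᵐ p ∂(parMeas N Ω T), ∀ h, timeMollFun N v0 v h p.1 p.2 =
      timeMollFun N w0 (fun t x => w (t, x)) h p.1 p.2 := by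
    unfold parMeas at *
    have hsw : ∀ᵐ x ∂(volume.restrict Ω), ∀ᵐ t ∂(volume.restrict (Ioo 0 T)), v t x = w (t, x) := by
      have := (Measure.measurePreserving_swap (μ := volume.restrict Ω)
        (ν := (volume : Measure ℝ).restrict (Ioo 0 T))).quasiMeasurePreserving.ae hw
      exact Measure.ae_ae_of_ae_prod this
    have h1 := Measure.quasiMeasurePreserving_snd
      (μ := (volume : Measure ℝ).restrict (Ioo 0 T)) (ν := volume.restrict Ω) |>.ae (hsw.and hw0)
    have h2 := Measure.quasiMeasurePreserving_fst
      (μ := (volume : Measure ℝ).restrict (Ioo 0 T)) (ν := volume.restrict Ω) |>.ae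
        (ae_restrict_mem measurableSet_Ioo)
    filter_upwards [h1, h2] with p hp1 hp2 h
    unfold timeMollFun
    rw [hp1.2]
    congr 2
    refine integral_congr_ae ?_
    filter_upwards [ae_restrict_of_ae_restrict_of_subset (Ioo_subset_Ioo_right hp2.2.le) hp1.1]
      with s hs
    rw [hs]
  have hSw : (fun p : ℝ × Euc N => S p.2 (v p.1 p.2)) =ᵐ[parMeas N Ω T]
      fun p => S p.2 (w (p.1, p.2)) := by
    filter_upwards [hw] with p hp
    rw [hp]
  have hSw0 : (fun x => S x (v0 x)) =ᵐ[volume.restrict Ω] fun x => S x (w0 x) := by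
    filter_upwards [hw0] with p hp
    rw [hp]
  have hSm : ∀ h, (fun p : ℝ × Euc N => S p.2 (timeMollFun N v0 v h p.1 p.2)) =ᵐ[parMeas N Ω T]
      fun p => S p.2 (timeMollFun N w0 (fun t x => w (t, x)) h p.1 p.2) := by
    intro h
    filter_upwards [hmoll] with p hp
    rw [hp]
  obtain ⟨c1, c2⟩ := denoising_core N Ω T hT S hSmeas hScont hSconv (fun t x => w (t, x)) hwm
    (hv.congr hw) (hSv.congr hSw) w0 hw0m (hSv0.congr hSw0)
  refine ⟨fun h hh => (c1 h hh).congr (hSm h).symm, ?_⟩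
  rw [integral_congr_ae hSw]
  refine c2.congr fun h => ?_
  exact integral_congr_ae (hSm h).symm
end
end

section
/- Compactness in the Gagliardo BV space with fixed exterior datum: Let N ≥ 1, α ∈ (0,1), Ω ⊂ ℝ^N a bounded open set, and u_0 ∈ BV_G^α(ℝ^N). Assume (f_k)_{k≥1} ⊂ BV_G^α(Ω;u_0) satisfies sup_{k≥1} ( ‖f_k‖_{L^1(Ω)} + TV_G^α(f_k;ℝ^N) ) < ∞. Then there exists f ∈ BV_G^α(Ω;u_0) such that TV_G^α(f;ℝ^N) ≤ liminf_{k→∞} TV_G^α(f_k;ℝ^N), and there is a subsequence (f_{k_i}) with ‖f_{k_i} − f‖_{L^p(ℝ^N)} → 0 as i → ∞ for every 1 ≤ p < N/(N−α). -/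
noncomputable section

open MeasureTheory Set Filter ENNReal
open scoped Topology

/-- The Gagliardo divergence `div_G F(x) = -∫ (F(x,y) - F(y,x))/|x-y|^{N+α} dy`
of a nonlocal vector field `F : ℝ^N × ℝ^N → ℝ`. -/
def gagDiv (N : ℕ) (α : ℝ) (F : Euc N → Euc N → ℝ) (x : Euc N) : ℝ :=
  -∫ y : Euc N, (F x y - F y x) / ‖x - y‖ ^ ((N : ℝ) + α)

/-- The Gagliardo fractional total variation `TV_G^α(f; ℝ^N)`. -/
def gagTV (N : ℕ) (α : ℝ) (f : Euc N → ℝ) : ℝ≥0∞ :=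
  ⨆ (Φ : Euc N → Euc N → ℝ)
    (_ : ContDiff ℝ (⊤ : ℕ∞) (fun p : Euc N × Euc N => Φ p.1 p.2))
    (_ : HasCompactSupport (fun p : Euc N × Euc N => Φ p.1 p.2))
    (_ : ∀ x y, |Φ x y| ≤ 1),
    ENNReal.ofReal (∫ x, f x * gagDiv N α Φ x)

/-- Membership in `BV_G^α(ℝ^N)`: integrable with finite Gagliardo total variation. -/
def MemBVG (N : ℕ) (α : ℝ) (f : Euc N → ℝ) : Prop :=
  Integrable f volume ∧ gagTV N α f < ⊤

/-- Membership in `BV_G^α(Ω; u₀)`: member of `BV_G^α(ℝ^N)` equal to `u₀` a.e. off `Ω`. -/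
def MemBVGb (N : ℕ) (α : ℝ) (Ω : Set (Euc N)) (u0 : Euc N → ℝ) (f : Euc N → ℝ) : Prop :=
  MemBVG N α f ∧ ∀ᵐ x ∂(volume : Measure (Euc N)), x ∉ Ω → f x = u0 x

/-- The product measure on the cylinder `ℝ^N × (0,T)`. -/
def cylMeas (N : ℕ) (T : ℝ) : Measure (ℝ × Euc N) :=
  (volume.restrict (Ioo 0 T)).prod (volume : Measure (Euc N))

/-- Membership in `L^1_w(0,T; BV_G^α(Ω; u₀))`. -/
def MemL1wBVG (N : ℕ) (α : ℝ) (Ω : Set (Euc N)) (u0 : Euc N → ℝ) (T : ℝ)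
    (v : ℝ → Euc N → ℝ) : Prop :=
  Integrable (fun p : ℝ × Euc N => v p.1 p.2) (cylMeas N T) ∧
  (∀ Φ : Euc N → Euc N → ℝ, ContDiff ℝ (⊤ : ℕ∞) (fun p : Euc N × Euc N => Φ p.1 p.2) →
    HasCompactSupport (fun p : Euc N × Euc N => Φ p.1 p.2) →
    AEMeasurable (fun t : ℝ => ∫ x, v t x * gagDiv N α Φ x)
      (volume.restrict (Ioo (0:ℝ) T))) ∧
  (∀ᵐ t ∂(volume.restrict (Ioo (0:ℝ) T)), MemBVGb N α Ω u0 (v t)) ∧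
  ∫⁻ t in Ioo (0:ℝ) T, gagTV N α (v t) < ⊤


def gagH (N : ℕ) (α : ℝ) (f : Euc N → ℝ) (x y : Euc N) : ℝ :=
  (f x - f y) / ‖x - y‖ ^ ((N : ℝ) + α)

def gagG (N : ℕ) (α : ℝ) (f : Euc N → ℝ) (x : Euc N) : ℝ≥0∞ :=
  ∫⁻ y, ‖gagH N α f x y‖ₑ

lemma gagTV_congr (N : ℕ) (α : ℝ) {f g : Euc N → ℝ} (h : f =ᵐ[volume] g) :
    gagTV N α f = gagTV N α g := by
  unfold gagTV
  congr! 6 with Φ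
  apply integral_congr_ae
  filter_upwards [h] with x hx
  rw [hx]

lemma measurable_gagH (N : ℕ) (α : ℝ) {f : Euc N → ℝ} (hf : Measurable f) :
    Measurable (fun p : Euc N × Euc N => gagH N α f p.1 p.2) := by
  unfold gagH
  fun_prop

lemma measurable_gagG (N : ℕ) (α : ℝ) {f : Euc N → ℝ} (hf : Measurable f) :
    Measurable (gagG N α f) := by
  unfold gagG
  exact (measurable_gagH N α hf).enorm.lintegral_prod_right'

lemma gagG_sub_le (N : ℕ) (α : ℝ) {f g : Euc N → ℝ} (hf : Measurable f) (x : Euc N) :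
    gagG N α (fun x => f x - g x) x ≤ gagG N α f x + gagG N α g x := by
  unfold gagG
  rw [← lintegral_add_left]
  · apply lintegral_mono
    intro y
    have : gagH N α (fun x => f x - g x) x y = gagH N α f x y - gagH N α g x y := by
      unfold gagH; ring
    simp only [this]
    exact enorm_sub_le
  · exact ((measurable_gagH N α hf).comp measurable_prodMk_left).enorm

lemma gagJ_sub_le (N : ℕ) (α : ℝ) {f g : Euc N → ℝ} (hf : Measurable f) :
    ∫⁻ x, gagG N α (fun x => f x - g x) x ≤ (∫⁻ x, gagG N α f x) + ∫⁻ x, gagG N α g x := by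
  rw [← lintegral_add_left (measurable_gagG N α hf)]
  exact lintegral_mono fun x => gagG_sub_le N α hf x

lemma gag_pointwise (N : ℕ) {α : ℝ} (hα : 0 < α) {v : Euc N → ℝ}
    (hi : Integrable v) (x c : Euc N) (r : ℝ) (hx : x ∈ Metric.ball c r) :
    ‖v x‖ₑ * volume (Metric.ball c r) ≤
      ENNReal.ofReal ((2 * r) ^ ((N : ℝ) + α)) * gagG N α v x
        + ‖∫ y in Metric.ball c r, v y‖ₑ := by
  have hs : (0:ℝ) < (N : ℝ) + α := by positivity
  have hB : volume (Metric.ball c r) ≠ ⊤ := measure_ball_lt_top.ne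
  have h1 : ‖v x‖ₑ * volume (Metric.ball c r) = ‖∫ y in Metric.ball c r, v x‖ₑ := by
    rw [setIntegral_const, enorm_smul, mul_comm, Measure.real]
    congr 1
    rw [Real.enorm_eq_ofReal ENNReal.toReal_nonneg, ENNReal.ofReal_toReal hB]
  have h2 : ∫ y in Metric.ball c r, v x =
      (∫ y in Metric.ball c r, (v x - v y)) + ∫ y in Metric.ball c r, v y := by
    rw [← integral_add]
    · simp
    · exact (integrableOn_const hB).sub hi.integrableOn
    · exact hi.integrableOn
  rw [h1, h2]
  refine (enorm_add_le _ _).trans ?_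
  gcongr
  refine (enorm_integral_le_lintegral_enorm _).trans ?_
  unfold gagG
  rw [← lintegral_const_mul' _ _ ENNReal.ofReal_ne_top]
  refine le_trans (setLIntegral_mono' measurableSet_ball ?_) (setLIntegral_le_lintegral _ _)
  intro y hy
  have hd : ‖x - y‖ ≤ 2 * r := by
    rw [← dist_eq_norm]
    have := dist_triangle_right x y c
    rw [Metric.mem_ball] at hx hy
    linarith
  rcases eq_or_ne x y with rfl | hxy
  · simp
  have hp : 0 < ‖x - y‖ := by rwa [norm_pos_iff, sub_ne_zero]
  have hp' : 0 < ‖x - y‖ ^ ((N : ℝ) + α) := by positivity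
  have h2r : 0 ≤ 2 * r := hp.le.trans hd
  have h2r' : 0 ≤ (2 * r) ^ ((N : ℝ) + α) := Real.rpow_nonneg h2r _
  rw [← Real.enorm_eq_ofReal h2r', ← enorm_mul]
  rw [enorm_le_iff_norm_le, norm_mul, gagH, norm_div, Real.norm_of_nonneg hp'.le,
    Real.norm_of_nonneg h2r', mul_div_assoc', le_div_iff₀ hp', mul_comm]
  exact mul_le_mul_of_nonneg_right (Real.rpow_le_rpow hp.le hd hs.le) (norm_nonneg _)

lemma gagDiv_measurable (N : ℕ) (α : ℝ) {Φ : Euc N → Euc N → ℝ}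
    (hΦ : ContDiff ℝ (⊤ : ℕ∞) (fun p : Euc N × Euc N => Φ p.1 p.2)) :
    Measurable (gagDiv N α Φ) := by
  have hm : Measurable (fun p : Euc N × Euc N => Φ p.1 p.2) := hΦ.continuous.measurable
  have : StronglyMeasurable (fun p : Euc N × Euc N =>
      (Φ p.1 p.2 - Φ p.2 p.1) / ‖p.1 - p.2‖ ^ ((N : ℝ) + α)) := by
    apply Measurable.stronglyMeasurable
    have h2 : Measurable (fun p : Euc N × Euc N => Φ p.2 p.1) := hm.comp measurable_swap
    fun_prop
  exact (this.integral_prod_right').measurable.neg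

lemma integrable_ball_rpow (N : ℕ) (hN : 1 ≤ N) {α : ℝ} (hα1 : α < 1) (R : ℝ) (hR : 0 < R) :
    Integrable (fun z : Euc N => (Iic R).indicator (fun t : ℝ => t ^ (1 - ((N : ℝ) + α))) ‖z‖) := by
  have : Nonempty (Fin N) := ⟨⟨0, hN⟩⟩
  rw [integrable_fun_norm_addHaar]
  have h1 : IntegrableOn (fun t : ℝ => t ^ (-α)) (Ioc 0 R) := by
    have := (intervalIntegral.intervalIntegrable_rpow' (a := 0) (b := R) (r := -α) (by linarith))
    rwa [intervalIntegrable_iff_integrableOn_Ioc_of_le hR.le] at this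
  have h2 : IntegrableOn ((Ioc 0 R).indicator (fun t : ℝ => t ^ (-α))) (Ioi 0) :=
    ((integrable_indicator_iff measurableSet_Ioc).2 h1).integrableOn
  refine h2.congr_fun ?_ measurableSet_Ioi
  intro t ht
  have ht' : (0:ℝ) < t := ht
  simp only [finrank_euclideanSpace, Fintype.card_fin, smul_eq_mul, indicator, mem_Ioc, mem_Iic, ht', true_and]
  split_ifs
  · rw [← Real.rpow_natCast, ← Real.rpow_add ht']
    congr 1
    push_cast [hN]
    ring
  · simp

lemma gagDiv_bounded (N : ℕ) (hN : 1 ≤ N) {α : ℝ} (hα : α ∈ Ioo (0:ℝ) 1) {Φ : Euc N → Euc N → ℝ}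
    (hΦ : ContDiff ℝ (⊤ : ℕ∞) (fun p : Euc N × Euc N => Φ p.1 p.2))
    (hc : HasCompactSupport (fun p : Euc N × Euc N => Φ p.1 p.2)) :
    ∃ C, ∀ x, |gagDiv N α Φ x| ≤ C := by
  obtain ⟨L, hL⟩ := hΦ.lipschitzWith_of_hasCompactSupport hc (by simp)
  obtain ⟨R, hR0, hR⟩ := hc.isCompact.isBounded.exists_pos_norm_le
  have hsupp : ∀ x y, Φ x y ≠ 0 → ‖x‖ ≤ R ∧ ‖y‖ ≤ R := by
    intro x y h
    have := hR (x, y) (subset_tsupport _ h)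
    exact ⟨(norm_fst_le (x,y)).trans this, (norm_snd_le (x,y)).trans this⟩
  set w : ℝ → ℝ := (Iic (2 * R)).indicator (fun t : ℝ => t ^ (1 - ((N : ℝ) + α))) with hw
  have hwi := integrable_ball_rpow N hN hα.2 (2 * R) (by positivity)
  refine ⟨∫ z : Euc N, L * w ‖z‖, fun x => ?_⟩
  have hwi2 : Integrable (fun y => L * w ‖x - y‖) := (hwi.const_mul (L : ℝ)).comp_sub_left x
  have : ∫ z : Euc N, L * w ‖z‖ = ∫ y : Euc N, L * w ‖x - y‖ :=
    (integral_sub_left_eq_self (fun z : Euc N => L * w ‖z‖) volume x).symm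
  rw [this, gagDiv, abs_neg, ← Real.norm_eq_abs]
  refine norm_integral_le_of_norm_le hwi2 (Eventually.of_forall fun y => ?_)
  by_cases hz : Φ x y - Φ y x = 0
  · rw [hz, zero_div, norm_zero]
    have : 0 ≤ w ‖x - y‖ := by
      rw [hw, indicator_apply]; split_ifs <;> positivity
    positivity
  have hxy : x ≠ y := by rintro rfl; simp at hz
  have hp : 0 < ‖x - y‖ := by rwa [norm_pos_iff, sub_ne_zero]
  have hb : ‖x‖ ≤ R ∧ ‖y‖ ≤ R := by
    by_cases h : Φ x y = 0
    · have : Φ y x ≠ 0 := by rintro h'; simp [h, h'] at hz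
      exact (hsupp _ _ this).symm
    · exact hsupp _ _ h
  have hle : ‖x - y‖ ≤ 2 * R := (norm_sub_le _ _).trans (by linarith [hb.1, hb.2])
  have hLip : ‖Φ x y - Φ y x‖ ≤ L * ‖x - y‖ := by
    have := hL.norm_sub_le (x, y) (y, x)
    simpa [Prod.norm_def, norm_sub_rev y x] using this
  rw [hw, indicator_of_mem (by exact hle), norm_div, Real.rpow_sub hp, Real.rpow_one, mul_div_assoc',
    Real.norm_of_nonneg (by positivity : 0 ≤ ‖x - y‖ ^ ((N : ℝ) + α))]
  gcongr

lemma gag_kernel_int (N : ℕ) {α : ℝ} (hα : 0 < α) {f : Euc N → ℝ}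
    (hi : Integrable f) {δ R : ℝ} (hδ : 0 < δ) {Ψ : Euc N × Euc N → ℝ}
    (hΨm : Measurable Ψ) (hb : ∀ p, |Ψ p| ≤ 1)
    (hs : ∀ p, Ψ p ≠ 0 → δ ≤ ‖p.1 - p.2‖ ∧ ‖p.1‖ ≤ R ∧ ‖p.2‖ ≤ R) :
    Integrable (fun p : Euc N × Euc N => f p.1 * (Ψ p / ‖p.1 - p.2‖ ^ ((N : ℝ) + α))) := by
  have hc : Integrable ((Metric.closedBall (0 : Euc N) R).indicator
      (fun _ => (δ ^ ((N : ℝ) + α))⁻¹)) := by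
    rw [integrable_indicator_iff measurableSet_closedBall]
    exact integrableOn_const (measure_closedBall_lt_top.ne)
  have hg := hi.norm.mul_prod hc
  refine Integrable.mono' hg ?_ (Eventually.of_forall fun p => ?_)
  · refine (hi.aestronglyMeasurable.comp_fst).mul ?_
    apply Measurable.aestronglyMeasurable
    fun_prop
  · rw [norm_mul]
    by_cases h : Ψ p = 0
    · simp only [h, zero_div, norm_zero, mul_zero]
      exact mul_nonneg (norm_nonneg _) (indicator_nonneg (fun _ _ => by positivity) _)
    obtain ⟨h1, h2, h3⟩ := hs p h
    have hp : 0 < ‖p.1 - p.2‖ := hδ.trans_le h1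
    rw [indicator_of_mem (by simpa using h3), norm_div, div_eq_mul_inv,
      Real.norm_of_nonneg (by positivity : 0 ≤ ‖p.1 - p.2‖ ^ ((N : ℝ) + α))]
    gcongr
    rw [← one_mul (δ ^ ((N : ℝ) + α))⁻¹]
    have := hb p
    rw [← Real.norm_eq_abs] at this
    gcongr

lemma gag_ibp (N : ℕ) {α : ℝ} (hα : 0 < α) {f : Euc N → ℝ}
    (hi : Integrable f) {δ R : ℝ} (hδ : 0 < δ) {Φ : Euc N → Euc N → ℝ}
    (hΦm : Measurable (fun p : Euc N × Euc N => Φ p.1 p.2)) (hb : ∀ x y, |Φ x y| ≤ 1)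
    (hs : ∀ x y, Φ x y ≠ 0 → δ ≤ ‖x - y‖ ∧ ‖x‖ ≤ R ∧ ‖y‖ ≤ R) :
    ∫ x, f x * gagDiv N α Φ x = - ∫ p : Euc N × Euc N, gagH N α f p.1 p.2 * Φ p.1 p.2 := by
  have hA := gag_kernel_int N hα hi hδ hΦm (fun p => hb p.1 p.2) (fun p h => hs p.1 p.2 h)
  have hB := gag_kernel_int N hα hi (R := R) hδ (Ψ := fun p => Φ p.2 p.1) (hΦm.comp measurable_swap)
    (fun p => hb p.2 p.1) (fun p h => by
      obtain ⟨h1, h2, h3⟩ := hs p.2 p.1 h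
      rw [norm_sub_rev] at h1
      exact ⟨h1, h3, h2⟩)
  have e1 : ∀ x, f x * gagDiv N α Φ x = - ∫ y,
      (f x * (Φ x y / ‖x - y‖ ^ ((N : ℝ) + α)) - f x * (Φ y x / ‖x - y‖ ^ ((N : ℝ) + α))) := by
    intro x
    rw [gagDiv, mul_neg, ← integral_const_mul]
    congr 2
    ext y
    ring
  simp_rw [e1]
  rw [integral_neg]
  congr 1
  have e2 := integral_prod _ (hA.sub hB)
  simp only [Pi.sub_apply] at e2
  rw [← e2]
  have e3 := integral_sub hA hB
  change ∫ a : Euc N × Euc N, _ ∂(volume.prod volume) = _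
  rw [Measure.volume_eq_prod] at hA hB e3 ⊢
  rw [e3, ← integral_prod_swap (fun p : Euc N × Euc N => f p.1 * (Φ p.2 p.1 / ‖p.1 - p.2‖ ^ ((N : ℝ) + α)))]
  have e4 := integral_sub hA hB.swap
  simp only [Function.comp_apply] at e4
  rw [← e4]
  congr 1
  ext p
  simp only [Prod.fst_swap, Prod.snd_swap, gagH, norm_sub_rev p.2 p.1]
  ring

lemma gag_le_TV (N : ℕ) {α : ℝ} (hα : 0 < α) {f : Euc N → ℝ}
    (hi : Integrable f) {δ R : ℝ} (hδ : 0 < δ) {Φ : Euc N → Euc N → ℝ}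
    (hΦ : ContDiff ℝ (⊤ : ℕ∞) (fun p : Euc N × Euc N => Φ p.1 p.2))
    (hb : ∀ x y, |Φ x y| ≤ 1)
    (hs : ∀ x y, Φ x y ≠ 0 → δ ≤ ‖x - y‖ ∧ ‖x‖ ≤ R ∧ ‖y‖ ≤ R) :
    ENNReal.ofReal (∫ p : Euc N × Euc N, gagH N α f p.1 p.2 * Φ p.1 p.2) ≤ gagTV N α f := by
  have hm : Measurable (fun p : Euc N × Euc N => - Φ p.1 p.2) := hΦ.continuous.measurable.neg
  have h := gag_ibp N hα hi hδ (Φ := fun x y => - Φ x y) (R := R) hm (by simpa using hb)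
    (by simpa using hs)
  simp only [mul_neg, integral_neg, neg_neg] at h
  rw [← h]
  unfold gagTV
  refine le_iSup_of_le (fun x y => - Φ x y) (le_iSup_of_le hΦ.neg (le_iSup_of_le ?_
    (le_iSup_of_le (by simpa using hb) le_rfl)))
  refine HasCompactSupport.intro (isCompact_closedBall (0 : Euc N × Euc N) R) ?_
  intro p hp
  by_contra h0
  apply hp
  obtain ⟨-, h2, h3⟩ := hs p.1 p.2 (by simpa using h0)
  rw [mem_closedBall_zero_iff, Prod.norm_def]
  exact max_le h2 h3

def gagK (N : ℕ) (δ R : ℝ) : Set (Euc N × Euc N) :=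
  {p | δ ≤ ‖p.1 - p.2‖ ∧ ‖p.1‖ ≤ R ∧ ‖p.2‖ ≤ R}

lemma gagK_meas (N : ℕ) (δ R : ℝ) : MeasurableSet (gagK N δ R) := by
  unfold gagK
  refine IsClosed.measurableSet ?_
  exact (isClosed_le (f := fun _ => δ) (g := fun p : Euc N × Euc N => ‖p.1 - p.2‖)
      (by fun_prop) (by fun_prop)).inter
    ((isClosed_le (f := fun p : Euc N × Euc N => ‖p.1‖) (g := fun _ => R)
      (by fun_prop) (by fun_prop)).inter
    (isClosed_le (f := fun p : Euc N × Euc N => ‖p.2‖) (g := fun _ => R)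
      (by fun_prop) (by fun_prop)))

lemma gagH_intOn (N : ℕ) {α : ℝ} (hα : 0 < α) {f : Euc N → ℝ}
    (hi : Integrable f) {δ R : ℝ} (hδ : 0 < δ) :
    Integrable ((gagK N δ R).indicator (fun p => gagH N α f p.1 p.2)) := by
  classical
  have hm : Measurable ((gagK N δ R).indicator (fun _ => (1:ℝ))) :=
    measurable_const.indicator (gagK_meas N δ R)
  have hA := gag_kernel_int N hα hi hδ (R := R) hm
    (fun p => by rw [indicator_apply]; split_ifs <;> simp) (fun p h => by
      by_contra h'
      have h' : p ∉ gagK N δ R := h'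
      exact h (indicator_of_notMem h' _))
  rw [Measure.volume_eq_prod] at hA ⊢
  refine (hA.sub hA.swap).congr (Eventually.of_forall fun p => ?_)
  have e : p.swap ∈ gagK N δ R ↔ p ∈ gagK N δ R := by
    simp only [gagK, mem_ofPred_eq, Prod.fst_swap, Prod.snd_swap, norm_sub_rev p.2 p.1]
    tauto
  simp only [Pi.sub_apply, Function.comp_apply, indicator_apply, e, gagH, Prod.fst_swap, Prod.snd_swap,
    norm_sub_rev p.2 p.1]
  split_ifs
  · ring
  · simp

open scoped Convolution in
lemma gag_K_le (N : ℕ) {α : ℝ} (hα : 0 < α) {f : Euc N → ℝ} (hf : Measurable f)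
    (hi : Integrable f) {δ R : ℝ} (hδ : 0 < δ) :
    ∫⁻ p in gagK N δ R, ‖gagH N α f p.1 p.2‖ₑ ≤ gagTV N α f := by
  classical
  have hHaar : (volume : Measure (Euc N × Euc N)).IsAddHaarMeasure := by
    rw [Measure.volume_eq_prod]; infer_instance
  have hNeg : (volume : Measure (Euc N × Euc N)).IsNegInvariant :=
    Measure.IsAddHaarMeasure.isNegInvariant_of_regular (G := Euc N × Euc N) (μ := volume)
  set h : Euc N × Euc N → ℝ := fun p => gagH N α f p.1 p.2 with hh
  have hhm : Measurable h := measurable_gagH N α hf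
  set s : Euc N × Euc N → ℝ := (gagK N δ R).indicator (fun p => SignType.sign (h p)) with hsdef
  have hsb : ∀ p, ‖s p‖ ≤ 1 := by
    intro p
    rw [hsdef, indicator_apply]
    split_ifs
    · rcases lt_trichotomy (h p) 0 with h | h | h <;> simp [h]
    · simp
  have hsm : Measurable s := by
    refine Measurable.indicator ?_ (gagK_meas N δ R)
    have : (fun p => ((SignType.sign (h p) : SignType) : ℝ)) =
        fun p => if 0 < h p then 1 else if h p < 0 then -1 else 0 := by
      ext p
      rcases lt_trichotomy (h p) 0 with h | h | h <;> simp [h, h.le]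
    rw [this]
    exact Measurable.ite (measurableSet_lt measurable_const hhm) measurable_const
      (Measurable.ite (measurableSet_lt hhm measurable_const) measurable_const measurable_const)
  have hsl : LocallyIntegrable s := by
    have : LocallyIntegrable (fun _ : Euc N × Euc N => (1:ℝ)) := locallyIntegrable_const 1
    refine this.mono hsm.aestronglyMeasurable (Eventually.of_forall fun p => ?_)
    simpa using hsb p
  let φ : ℕ → ContDiffBump (0 : Euc N × Euc N) := fun n =>
    { rIn := min 1 (δ / 4) / (n + 1) / 2
      rOut := min 1 (δ / 4) / (n + 1)
      rIn_pos := by positivity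
      rIn_lt_rOut := half_lt_self (by positivity) }
  have hφ0 : Tendsto (fun n => (φ n).rOut) atTop (𝓝 0) := by
    have := tendsto_one_div_add_atTop_nhds_zero_nat (𝕜 := ℝ)
    have := this.const_mul (min 1 (δ / 4))
    simpa [φ, div_eq_mul_inv] using this
  have hφr : ∀ n, (φ n).rOut ≤ min 1 (δ / 4) := by
    intro n
    have : (0:ℝ) < min 1 (δ / 4) := by positivity
    exact div_le_self this.le (by simp)
  set Ψ : ℕ → Euc N × Euc N → ℝ := fun n =>
    ((φ n).normed volume ⋆[ContinuousLinearMap.lsmul ℝ ℝ, volume] s) with hΨ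
  have hlim : ∀ᵐ p, Tendsto (fun n => Ψ n p) atTop (𝓝 (s p)) :=
    ContDiffBump.ae_convolution_tendsto_right_of_locallyIntegrable (μ := volume)
    (φ := φ) (K := 2) hφ0 (Eventually.of_forall fun n => by simp only [φ]; linarith) hsl
  have hΨs : ∀ n, ContDiff ℝ (⊤ : ℕ∞) (Ψ n) := fun n =>
    (φ n).hasCompactSupport_normed.contDiff_convolution_left _ (φ n).contDiff_normed hsl
  have hΨb : ∀ n p, |Ψ n p| ≤ 1 := by
    intro n p
    rw [← Real.norm_eq_abs]
    have e : ∫ t, (φ n).normed volume t ∂volume = 1 := (φ n).integral_normed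
    rw [← e]
    refine norm_integral_le_of_norm_le (φ n).integrable_normed (Eventually.of_forall fun t => ?_)
    simp only [ContinuousLinearMap.lsmul_apply, norm_smul]
    have h0 := (φ n).nonneg_normed (μ := volume) t
    rw [Real.norm_of_nonneg h0]
    exact mul_le_of_le_one_right h0 (hsb _)
  have hΨsupp : ∀ n p, Ψ n p ≠ 0 → p ∈ gagK N (δ / 2) (R + 1) := by
    intro n p hp
    obtain ⟨a, ha, b, hb, rfl⟩ := support_convolution_subset _ hp
    rw [(φ n).support_normed_eq, mem_ball_zero_iff] at ha
    have hb' : b ∈ gagK N δ R := by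
      by_contra h'
      exact hb (indicator_of_notMem h' _)
    obtain ⟨b1, b2, b3⟩ := hb'
    have ha1 := (norm_fst_le a).trans (ha.le.trans (hφr n))
    have ha2 := (norm_snd_le a).trans (ha.le.trans (hφr n))
    have hm1 := min_le_left 1 (δ / 4)
    have hm2 := min_le_right 1 (δ / 4)
    refine ⟨?_, ?_, ?_⟩
    · have : b.1 - b.2 = ((a + b).1 - (a + b).2) - (a.1 - a.2) := by simp; abel
      have h3 : ‖b.1 - b.2‖ ≤ ‖(a + b).1 - (a + b).2‖ + ‖a.1 - a.2‖ := by
        rw [this]; exact norm_sub_le _ _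
      have h4 := norm_sub_le a.1 a.2
      linarith
    · have := norm_add_le a.1 b.1
      simp only [Prod.fst_add]
      linarith
    · have := norm_add_le a.2 b.2
      simp only [Prod.snd_add]
      linarith
  clear_value Ψ
  have hbd : Integrable (fun p => ‖(gagK N (δ/2) (R+1)).indicator h p‖) :=
    (gagH_intOn N hα hi (by positivity)).norm
  have hT : Tendsto (fun n => ∫ p, h p * Ψ n p) atTop (𝓝 (∫ p, h p * s p)) := by
    refine tendsto_integral_filter_of_dominated_convergence _ ?_ ?_ hbd ?_
    · exact Eventually.of_forall fun n => (hhm.mul (hΨs n).continuous.measurable).aestronglyMeasurable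
    · refine Eventually.of_forall fun n => Eventually.of_forall fun p => ?_
      by_cases h0 : Ψ n p = 0
      · simp [h0]
      rw [indicator_of_mem (hΨsupp n p h0), norm_mul]
      exact mul_le_of_le_one_right (norm_nonneg _) (hΨb n p)
    · filter_upwards [hlim] with p hp
      exact hp.const_mul _
  have hT2 := (ENNReal.continuous_ofReal.tendsto _).comp hT
  have hle : ENNReal.ofReal (∫ p, h p * s p) ≤ gagTV N α f := by
    refine le_of_tendsto hT2 (Eventually.of_forall fun n => ?_)
    exact gag_le_TV N hα hi (δ := δ / 2) (R := R + 1) (by positivity) (Φ := fun x y => Ψ n (x, y))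
      (hΨs n) (fun x y => hΨb n (x, y)) (fun x y hxy => by
        obtain ⟨h1, h2, h3⟩ := hΨsupp n (x, y) hxy
        exact ⟨h1, h2, h3⟩)
  refine le_trans (le_of_eq ?_) hle
  have e : ∀ p, h p * s p = ‖(gagK N δ R).indicator h p‖ := by
    intro p
    rw [hsdef, indicator_apply, indicator_apply]
    split_ifs
    · rw [self_mul_sign, Real.norm_eq_abs]
    · simp
  simp_rw [e]
  rw [ofReal_integral_norm_eq_lintegral_enorm (gagH_intOn N hα hi hδ)]
  rw [← lintegral_indicator (gagK_meas N δ R)]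
  congr 1
  ext p
  rw [enorm_indicator_eq_indicator_enorm]

lemma gag_J_le (N : ℕ) {α : ℝ} (hα : 0 < α) {f : Euc N → ℝ} (hf : Measurable f)
    (hi : Integrable f) :
    ∫⁻ x, gagG N α f x ≤ gagTV N α f := by
  classical
  have h1 : ∫⁻ x, gagG N α f x = ∫⁻ p : Euc N × Euc N, ‖gagH N α f p.1 p.2‖ₑ := by
    rw [Measure.volume_eq_prod, lintegral_prod _ (measurable_gagH N α hf).enorm.aemeasurable]
    rfl
  rw [h1]
  have h2 : ∫⁻ p : Euc N × Euc N, ‖gagH N α f p.1 p.2‖ₑ =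
      ∫⁻ p in ⋃ n : ℕ, gagK N (1 / ((n : ℝ) + 1)) n, ‖gagH N α f p.1 p.2‖ₑ := by
    symm
    rw [← lintegral_indicator (MeasurableSet.iUnion fun n => gagK_meas N _ _)]
    congr 1
    ext p
    rw [indicator_apply]
    split_ifs with h
    · rfl
    symm
    by_cases he : p.1 = p.2
    · simp [gagH, he]
    exfalso
    apply h
    have hp : 0 < ‖p.1 - p.2‖ := by rwa [norm_pos_iff, sub_ne_zero]
    obtain ⟨n1, hn1⟩ := exists_nat_one_div_lt hp
    obtain ⟨n2, hn2⟩ := exists_nat_ge ‖p.1‖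
    obtain ⟨n3, hn3⟩ := exists_nat_ge ‖p.2‖
    rw [mem_iUnion]
    refine ⟨max n1 (max n2 n3), ?_, ?_, ?_⟩
    · refine le_trans ?_ hn1.le
      gcongr
      exact le_max_left _ _
    · exact hn2.trans (by simp)
    · exact hn3.trans (by simp)
  rw [h2, setLIntegral_iUnion_of_directed]
  · exact iSup_le fun n => gag_K_le N hα hf hi (by positivity)
  · refine Monotone.directed_le (f := fun n : ℕ => gagK N (1 / ((n : ℝ) + 1)) n) ?_
    intro m n hmn p hp
    have hmn' : (m : ℝ) ≤ n := by exact_mod_cast hmn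
    refine ⟨le_trans ?_ hp.1, hp.2.1.trans hmn', hp.2.2.trans hmn'⟩
    gcongr

lemma gag_improve_pt (N : ℕ) (hN : 1 ≤ N) {α : ℝ} (hα : 0 < α) {q : ℝ} (hq : 1 ≤ q) :
    ∃ C : ℝ, 0 < C ∧ ∀ v : Euc N → ℝ, Integrable v → ∀ A : ℝ, 0 < A →
      eLpNorm v (ENNReal.ofReal q) volume ≤ ENNReal.ofReal A → ∀ x,
      ‖v x‖ₑ ^ (1 + α * q / N) ≤ ENNReal.ofReal (C * A ^ (α * q / N)) * gagG N α v x := by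
  have : Nonempty (Fin N) := ⟨⟨0, hN⟩⟩
  have hN0 : (0:ℝ) < N := by exact_mod_cast hN
  set ω : ℝ := (volume (Metric.ball (0 : Euc N) 1)).toReal with hω
  have hω0 : 0 < ω := ENNReal.toReal_pos (Metric.measure_ball_pos _ _ one_pos).ne'
    measure_ball_lt_top.ne
  set γ : ℝ := α * q / N with hγ
  have hγ0 : 0 < γ := by positivity
  refine ⟨2 * 2 ^ ((N : ℝ) + α) * ω⁻¹ ^ (1 + α / N) * 2 ^ γ, by positivity, ?_⟩
  intro v hi A hA hvA x
  set C : ℝ := 2 * 2 ^ ((N : ℝ) + α) * ω⁻¹ ^ (1 + α / N) * 2 ^ γ with hC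
  have hC0 : 0 < C := by positivity
  rcases eq_or_ne (v x) 0 with h0 | h0
  · rw [h0, enorm_zero, ENNReal.zero_rpow_of_pos (by positivity)]; exact zero_le
  have ht : 0 < ‖v x‖ := norm_pos_iff.2 h0
  set t := ‖v x‖ with htdef
  rcases eq_or_ne (gagG N α v x) ⊤ with hG | hG
  · rw [hG, ENNReal.mul_top]
    · exact le_top
    · exact (ENNReal.ofReal_pos.2 (by positivity)).ne'
  set g := (gagG N α v x).toReal with hg
  have hg0 : 0 ≤ g := ENNReal.toReal_nonneg
  have hGg : gagG N α v x = ENNReal.ofReal g := (ENNReal.ofReal_toReal hG).symm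
  set V : ℝ := (2 * A / t) ^ q with hV
  have hV0 : 0 < V := by positivity
  set r : ℝ := (V / ω) ^ (1 / (N : ℝ)) with hr
  have hr0 : 0 < r := by positivity
  have hrN : r ^ N = V / ω := by
    rw [hr, ← Real.rpow_natCast, ← Real.rpow_mul (by positivity)]
    rw [one_div_mul_cancel hN0.ne', Real.rpow_one]
  have hvol : volume (Metric.ball x r) = ENNReal.ofReal V := by
    rw [Measure.addHaar_ball _ _ hr0.le, finrank_euclideanSpace, Fintype.card_fin, hrN,
      ← ENNReal.ofReal_toReal (measure_ball_lt_top (x := (0 : Euc N)) (r := 1) (μ := volume)).ne, ← hω,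
      ← ENNReal.ofReal_mul (by positivity)]
    congr 1
    field_simp
  have h1 := gag_pointwise N hα hi x x r (Metric.mem_ball_self hr0)
  have h2 : ‖∫ y in Metric.ball x r, v y‖ₑ ≤ ENNReal.ofReal (A * V ^ (1 - 1 / q)) := by
    refine (enorm_integral_le_lintegral_enorm _).trans ?_
    rw [← eLpNorm_one_eq_lintegral_enorm]
    refine (eLpNorm_le_eLpNorm_mul_rpow_measure_univ (q := ENNReal.ofReal q)
      (by rw [← ENNReal.ofReal_one]; exact ENNReal.ofReal_le_ofReal hq)
      hi.aestronglyMeasurable.restrict).trans ?_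
    rw [Measure.restrict_apply_univ, hvol, ENNReal.toReal_ofReal (by positivity), ENNReal.toReal_one,
      ENNReal.ofReal_rpow_of_pos hV0, ENNReal.ofReal_mul hA.le, div_one]
    gcongr
    exact (eLpNorm_restrict_le _ _ _ _).trans hvA
  have h3 : A * V ^ (1 - 1 / q) = t * V / 2 := by
    rw [Real.rpow_sub hV0, Real.rpow_one]
    have : V ^ (1 / q) = 2 * A / t := by
      rw [hV, ← Real.rpow_mul (by positivity), mul_one_div_cancel (by positivity), Real.rpow_one]
    rw [this]
    field_simp
  have hte : ‖v x‖ₑ = ENNReal.ofReal t := by rw [htdef, ofReal_norm]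
  have h4 : t * V ≤ (2 * r) ^ ((N : ℝ) + α) * g + t * V / 2 := by
    rw [h3] at h2
    have h5 := h1.trans (add_le_add_right h2 _)
    rw [hte, hvol, hGg, ← ENNReal.ofReal_mul ht.le, ← ENNReal.ofReal_mul (by positivity),
      ← ENNReal.ofReal_add (by positivity) (by positivity),
      ENNReal.ofReal_le_ofReal_iff (by positivity)] at h5
    exact h5
  have h6 : (2 * r) ^ ((N : ℝ) + α) = 2 ^ ((N : ℝ) + α) * ω⁻¹ ^ (1 + α / N) * (V * V ^ (α / N)) := by
    rw [Real.mul_rpow (by norm_num) hr0.le, hr, ← Real.rpow_mul (by positivity)]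
    have : 1 / (N:ℝ) * (N + α) = 1 + α / N := by field_simp
    rw [this, div_eq_mul_inv, Real.mul_rpow hV0.le (by positivity), Real.rpow_add hV0, Real.rpow_one]
    ring
  have h7 : V ^ (α / N) = 2 ^ γ * A ^ γ / t ^ γ := by
    rw [hV, ← Real.rpow_mul (by positivity), Real.div_rpow (by positivity) ht.le,
      Real.mul_rpow (by norm_num) hA.le]
    have : q * (α / N) = γ := by rw [hγ]; ring
    rw [this]
  have h8 : t ^ (1 + γ) ≤ C * A ^ γ * g := by
    rw [Real.rpow_add ht, Real.rpow_one]
    have htγ : 0 < t ^ γ := by positivity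
    rw [h6, h7] at h4
    have h9 : t * V / 2 ≤ 2 ^ ((N : ℝ) + α) * ω⁻¹ ^ (1 + α / N) *
        (V * (2 ^ γ * A ^ γ / t ^ γ)) * g := by linarith
    have h10 : t * t ^ γ = (t * V / 2) * (2 * t ^ γ / V) := by field_simp
    rw [h10]
    refine (mul_le_mul_of_nonneg_right h9 (by positivity)).trans (le_of_eq ?_)
    rw [hC]
    field_simp
  rw [hte, hGg, ENNReal.ofReal_rpow_of_pos ht, ← ENNReal.ofReal_mul (by positivity)]
  exact ENNReal.ofReal_le_ofReal h8

lemma gag_improve_tendsto (N : ℕ) (hN : 1 ≤ N) {α : ℝ} (hα : 0 < α) {q : ℝ} (hq : 1 ≤ q)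
    {v : ℕ → Euc N → ℝ} (hi : ∀ i, Integrable (v i)) {M : ℝ≥0∞} (hM : M ≠ ⊤)
    (hJ : ∀ i, ∫⁻ x, gagG N α (v i) x ≤ M)
    (h : Tendsto (fun i => eLpNorm (v i) (ENNReal.ofReal q) volume) atTop (𝓝 0)) :
    Tendsto (fun i => eLpNorm (v i) (ENNReal.ofReal (1 + α * q / N)) volume) atTop (𝓝 0) := by
  obtain ⟨C, hC0, hC⟩ := gag_improve_pt N hN hα hq
  have hN0 : (0:ℝ) < N := by exact_mod_cast hN
  set γ : ℝ := α * q / N with hγ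
  have hγ0 : 0 < γ := by positivity
  have key : Tendsto (fun i => ∫⁻ x, ‖v i x‖ₑ ^ (1 + γ)) atTop (𝓝 0) := by
    have hA : Tendsto (fun A : ℝ => ENNReal.ofReal (C * A ^ γ) * M) (𝓝[>] 0) (𝓝 0) := by
      have h1 : Tendsto (fun A : ℝ => C * A ^ γ) (𝓝[>] 0) (𝓝 0) := by
        have : ContinuousAt (fun A : ℝ => C * A ^ γ) 0 :=
          continuousAt_const.mul (Real.continuousAt_rpow_const _ _ (Or.inr hγ0.le))
        have h2 := this.tendsto
        simp only [Real.zero_rpow hγ0.ne', mul_zero] at h2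
        exact h2.mono_left nhdsWithin_le_nhds
      have h2 := ENNReal.tendsto_ofReal h1
      have h3 := ENNReal.Tendsto.mul_const (b := M) h2 (Or.inr hM)
      simpa using h3
    rw [ENNReal.tendsto_nhds_zero] at hA ⊢
    intro ε hε
    obtain ⟨A, hAε, hA0⟩ := ((hA ε hε).and self_mem_nhdsWithin).exists
    have hA0 : 0 < A := hA0
    rw [ENNReal.tendsto_nhds_zero] at h
    filter_upwards [h (ENNReal.ofReal A) (by simpa using hA0)] with i hiA
    calc ∫⁻ x, ‖v i x‖ₑ ^ (1 + γ) ≤ ∫⁻ x, ENNReal.ofReal (C * A ^ γ) * gagG N α (v i) x :=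
          lintegral_mono fun x => hC (v i) (hi i) A hA0 hiA x
      _ = ENNReal.ofReal (C * A ^ γ) * ∫⁻ x, gagG N α (v i) x :=
          lintegral_const_mul' _ _ ENNReal.ofReal_ne_top
      _ ≤ ENNReal.ofReal (C * A ^ γ) * M := by gcongr; exact hJ i
      _ ≤ ε := hAε
  have e : ∀ i, eLpNorm (v i) (ENNReal.ofReal (1 + γ)) volume =
      (∫⁻ x, ‖v i x‖ₑ ^ (1 + γ)) ^ (1 / (1 + γ)) := by
    intro i
    rw [eLpNorm_eq_lintegral_rpow_enorm_toReal (ENNReal.ofReal_pos.2 (by positivity)).ne'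
      ENNReal.ofReal_ne_top, ENNReal.toReal_ofReal (by positivity)]
  simp_rw [e]
  have := (ENNReal.continuous_rpow_const (y := 1 / (1 + γ))).tendsto 0 |>.comp key
  rw [ENNReal.zero_rpow_of_pos (by positivity)] at this
  exact this

def gagQ (a : ℝ) : ℕ → ℝ
  | 0 => 1
  | n + 1 => 1 + a * gagQ a n

lemma gagQ_ge {a : ℝ} (ha : 0 ≤ a) (n : ℕ) : 1 ≤ gagQ a n := by
  induction n with
  | zero => simp [gagQ]
  | succ n ih => simp only [gagQ]; have := mul_nonneg ha (zero_le_one.trans ih); linarith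

lemma gagQ_tendsto {a : ℝ} (ha : 0 ≤ a) (ha1 : a < 1) :
    Tendsto (gagQ a) atTop (𝓝 (1 - a)⁻¹) := by
  have h : ∀ n, gagQ a n = (1 - a)⁻¹ - a ^ n * (a * (1 - a)⁻¹) := by
    intro n
    have : 1 - a ≠ 0 := by linarith
    induction n with
    | zero => simp only [gagQ]; field_simp
    | succ n ih => simp only [gagQ, ih]; field_simp; ring
  have h2 := (tendsto_pow_atTop_nhds_zero_of_lt_one ha ha1).mul_const (a * (1 - a)⁻¹)
  have h3 := h2.const_sub (1 - a)⁻¹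
  simp only [zero_mul, sub_zero] at h3
  exact h3.congr fun n => (h n).symm

lemma gag_Lp (N : ℕ) (hN : 1 ≤ N) {α : ℝ} (hα : α ∈ Ioo (0:ℝ) 1)
    {Ω : Set (Euc N)} (hΩo : IsOpen Ω) (hΩb : Bornology.IsBounded Ω)
    {v : ℕ → Euc N → ℝ} (hi : ∀ i, Integrable (v i)) {M : ℝ≥0∞} (hM : M ≠ ⊤)
    (hJ : ∀ i, ∫⁻ x, gagG N α (v i) x ≤ M)
    (h0 : ∀ i, ∀ᵐ x, x ∉ Ω → v i x = 0)
    (h : Tendsto (fun i => eLpNorm (v i) 1 volume) atTop (𝓝 0))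
    (p : ℝ) (hp1 : 1 ≤ p) (hp : p < (N : ℝ) / ((N : ℝ) - α)) :
    Tendsto (fun i => eLpNorm (v i) (ENNReal.ofReal p) volume) atTop (𝓝 0) := by
  have hN0 : (1:ℝ) ≤ N := by exact_mod_cast hN
  have hα1 := hα.1
  have hα2 := hα.2
  set a := α / N with ha
  have ha0 : 0 ≤ a := by positivity
  have ha1 : a < 1 := by rw [ha, div_lt_one (by linarith)]; linarith
  have hQ : ∀ n, Tendsto (fun i => eLpNorm (v i) (ENNReal.ofReal (gagQ a n)) volume) atTop (𝓝 0) := by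
    intro n
    induction n with
    | zero => simpa [gagQ] using h
    | succ n ih =>
      have := gag_improve_tendsto N hN hα.1 (gagQ_ge ha0 n) hi hM hJ ih
      have e : gagQ a (n + 1) = 1 + α * gagQ a n / N := by simp only [gagQ, ha]; ring
      rwa [e]
  have hlim : p < (1 - a)⁻¹ := by
    convert hp using 1
    rw [ha]
    have : (N:ℝ) - α ≠ 0 := by linarith
    have : (N:ℝ) ≠ 0 := by linarith
    field_simp
  obtain ⟨n, hn⟩ := ((gagQ_tendsto ha0 ha1).eventually (lt_mem_nhds hlim)).exists
  have hΩf : volume Ω ≠ ⊤ := hΩb.measure_lt_top.ne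
  set e := (1 / (ENNReal.ofReal p).toReal - 1 / (ENNReal.ofReal (gagQ a n)).toReal) with he
  have he0 : 0 ≤ e := by
    rw [he, ENNReal.toReal_ofReal (by linarith), ENNReal.toReal_ofReal (by linarith), sub_nonneg]
    exact one_div_le_one_div_of_le (by linarith) hn.le
  have hle : ∀ i, eLpNorm (v i) (ENNReal.ofReal p) volume ≤
      eLpNorm (v i) (ENNReal.ofReal (gagQ a n)) volume * volume Ω ^ e := by
    intro i
    have e1 : eLpNorm (v i) (ENNReal.ofReal p) volume =
        eLpNorm (v i) (ENNReal.ofReal p) (volume.restrict Ω) := by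
      rw [← eLpNorm_indicator_eq_eLpNorm_restrict hΩo.measurableSet]
      apply eLpNorm_congr_ae
      filter_upwards [h0 i] with x hx
      by_cases hxΩ : x ∈ Ω
      · rw [indicator_of_mem hxΩ]
      · rw [indicator_of_notMem hxΩ, hx hxΩ]
    rw [e1]
    refine (eLpNorm_le_eLpNorm_mul_rpow_measure_univ (ENNReal.ofReal_le_ofReal hn.le)
      (hi i).aestronglyMeasurable.restrict).trans ?_
    rw [Measure.restrict_apply_univ]
    exact mul_le_mul_left (eLpNorm_mono_measure _ Measure.restrict_le_self) _
  have hT := ENNReal.Tendsto.mul_const (b := volume Ω ^ e) (hQ n)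
    (Or.inr (ENNReal.rpow_ne_top_of_nonneg he0 hΩf))
  rw [zero_mul] at hT
  exact tendsto_of_tendsto_of_tendsto_of_le_of_le tendsto_const_nhds hT (fun _ => zero_le) hle

lemma gag_avg (N : ℕ) (hN : 1 ≤ N) {α : ℝ} (hα : 0 < α) :
    ∃ K : ℝ≥0∞, K ≠ ⊤ ∧ ∀ v : Euc N → ℝ, Integrable v → ∀ (x c : Euc N) (r : ℝ),
      x ∈ Metric.ball c r → ‖v x‖ₑ ≤ K * ENNReal.ofReal (r ^ α) * gagG N α v x +
        (volume (Metric.ball (0 : Euc N) r))⁻¹ * ‖∫ y in Metric.ball c r, v y‖ₑ := by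
  have : Nonempty (Fin N) := ⟨⟨0, hN⟩⟩
  set W := volume (Metric.ball (0 : Euc N) 1) with hW
  have hW0 : W ≠ 0 := (Metric.measure_ball_pos _ _ one_pos).ne'
  have hWt : W ≠ ⊤ := measure_ball_lt_top.ne
  refine ⟨ENNReal.ofReal (2 ^ ((N : ℝ) + α)) * W⁻¹,
    ENNReal.mul_ne_top ENNReal.ofReal_ne_top (ENNReal.inv_ne_top.2 hW0), ?_⟩
  intro v hi x c r hx
  have hr : 0 < r := dist_nonneg.trans_lt hx
  have h := gag_pointwise N hα hi x c r hx
  have hv : volume (Metric.ball c r) = volume (Metric.ball (0 : Euc N) r) := by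
    rw [Measure.addHaar_ball _ c hr.le, Measure.addHaar_ball _ 0 hr.le]
  rw [hv] at h
  set V := volume (Metric.ball (0 : Euc N) r) with hV
  have hV0 : V ≠ 0 := (Metric.measure_ball_pos _ _ hr).ne'
  have hVt : V ≠ ⊤ := measure_ball_lt_top.ne
  have hVe : V = ENNReal.ofReal (r ^ N) * W := by
    rw [hV, Measure.addHaar_ball _ 0 hr.le, finrank_euclideanSpace, Fintype.card_fin]
  have h1 : ‖v x‖ₑ = V⁻¹ * (‖v x‖ₑ * V) := by
    rw [mul_comm, mul_assoc, ENNReal.mul_inv_cancel hV0 hVt, mul_one]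
  rw [h1]
  refine (mul_le_mul_right h V⁻¹).trans (le_of_eq ?_)
  rw [mul_add, ← mul_assoc]
  congr 2
  have hrN : ENNReal.ofReal (r ^ N) ≠ 0 := (ENNReal.ofReal_pos.2 (by positivity)).ne'
  rw [hVe, ENNReal.mul_inv (Or.inl hrN) (Or.inl ENNReal.ofReal_ne_top),
    Real.mul_rpow (by norm_num) hr.le, Real.rpow_add hr, Real.rpow_natCast,
    ENNReal.ofReal_mul (by positivity), ENNReal.ofReal_mul (by positivity)]
  calc (ENNReal.ofReal (r ^ N))⁻¹ * W⁻¹ * (ENNReal.ofReal (2 ^ ((N:ℝ) + α)) *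
        (ENNReal.ofReal (r ^ N) * ENNReal.ofReal (r ^ α)))
      = ((ENNReal.ofReal (r ^ N))⁻¹ * ENNReal.ofReal (r ^ N)) *
        (ENNReal.ofReal (2 ^ ((N:ℝ) + α)) * W⁻¹ * ENNReal.ofReal (r ^ α)) := by ring
    _ = _ := by rw [ENNReal.inv_mul_cancel hrN ENNReal.ofReal_ne_top, one_mul]

lemma gag_compact (N : ℕ) (hN : 1 ≤ N) {α : ℝ} (hα : 0 < α)
    {Ω : Set (Euc N)} (hΩo : IsOpen Ω) (hΩb : Bornology.IsBounded Ω)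
    {f : ℕ → Euc N → ℝ} (hm : ∀ k, Measurable (f k)) (hi : ∀ k, Integrable (f k))
    (h0 : ∀ k l, ∀ᵐ x, x ∉ Ω → f k x = f l x)
    {M1 M2 : ℝ≥0∞} (hM1 : M1 ≠ ⊤) (hM2 : M2 ≠ ⊤)
    (hL : ∀ k, ∫⁻ x, ‖f k x‖ₑ ≤ M1) (hJ : ∀ k, ∫⁻ x, gagG N α (f k) x ≤ M2) :
    ∃ φ : ℕ → ℕ, StrictMono φ ∧ Tendsto (fun p : ℕ × ℕ => ∫⁻ x, ‖f (φ p.1) x - f (φ p.2) x‖ₑ)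
      (atTop ×ˢ atTop) (𝓝 0) := by
  classical
  obtain ⟨K, hK, hKe⟩ := gag_avg N hN hα
  set d : ℕ → Euc N := TopologicalSpace.denseSeq (Euc N) with hd
  have hdd : DenseRange d := TopologicalSpace.denseRange_denseSeq (Euc N)
  set ρ : ℕ → ℝ := fun n => 1 / ((n : ℝ) + 1) with hρ
  have hρ0 : ∀ n, 0 < ρ n := fun n => by positivity
  set a : ℕ → (ℕ × ℕ → ℝ) := fun k j => ∫ y in Metric.ball (d j.1) (ρ j.2), f k y with ha
  have haM : ∀ k j, ‖a k j‖ₑ ≤ M1 := fun k j =>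
    (enorm_integral_le_lintegral_enorm _).trans ((setLIntegral_le_lintegral _ _).trans (hL k))
  have haM' : ∀ k, a k ∈ Set.pi univ (fun _ : ℕ × ℕ => Metric.closedBall (0:ℝ) M1.toReal) := by
    intro k j _
    rw [mem_closedBall_zero_iff, ← toReal_enorm]
    exact ENNReal.toReal_mono hM1 (haM k j)
  obtain ⟨b, -, φ, hφ, hab⟩ := (isCompact_univ_pi
    (fun _ : ℕ × ℕ => isCompact_closedBall (0:ℝ) M1.toReal)).tendsto_subseq haM'
  rw [tendsto_pi_nhds] at hab
  refine ⟨φ, hφ, ?_⟩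
  have hex : ∀ n x, ∃ i, x ∈ Metric.ball (d i) (ρ n) := by
    intro n x
    obtain ⟨i, hi⟩ := hdd.exists_dist_lt x (hρ0 n)
    exact ⟨i, hi⟩
  set ι : ℕ → Euc N → ℕ := fun n x => Nat.find (hex n x) with hι
  have hιm : ∀ n, Measurable (ι n) := fun n =>
    measurable_find (hex n) (fun k => measurableSet_ball)
  have hιs : ∀ n x, x ∈ Metric.ball (d (ι n x)) (ρ n) := fun n x => Nat.find_spec (hex n x)
  have hΩf : volume Ω ≠ ⊤ := hΩb.measure_lt_top.ne
  set I : ℕ → ℕ × ℕ → ℝ≥0∞ := fun n p =>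
    ∫⁻ x in Ω, ‖a (φ p.1) (ι n x, n) - a (φ p.2) (ι n x, n)‖ₑ with hI
  have hI0 : ∀ n, Tendsto (I n) (atTop ×ˢ atTop) (𝓝 0) := by
    intro n
    have e : (0:ℝ≥0∞) = ∫⁻ x in Ω, (0:ℝ≥0∞) := by simp
    rw [e]
    refine tendsto_lintegral_filter_of_dominated_convergence (fun _ => M1 + M1) ?_ ?_ ?_ ?_
    · refine Eventually.of_forall fun p => ?_
      have : Measurable (fun i : ℕ => ‖a (φ p.1) (i, n) - a (φ p.2) (i, n)‖ₑ) := measurable_from_nat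
      exact this.comp (hιm n)
    · refine Eventually.of_forall fun p => Eventually.of_forall fun x => ?_
      exact enorm_sub_le.trans (add_le_add (haM _ _) (haM _ _))
    · rw [lintegral_const, Measure.restrict_apply_univ]
      exact ENNReal.mul_ne_top (ENNReal.add_ne_top.2 ⟨hM1, hM1⟩) hΩf
    · refine Eventually.of_forall fun x => ?_
      have h1 := (hab (ι n x, n)).comp (tendsto_fst (f := atTop) (g := (atTop : Filter ℕ)))
      have h2 := (hab (ι n x, n)).comp (tendsto_snd (f := (atTop : Filter ℕ)) (g := atTop))
      have h3 := (h1.sub h2).enorm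
      simpa using h3
  have hbound : ∀ n p, ∫⁻ x, ‖f (φ p.1) x - f (φ p.2) x‖ₑ ≤
      K * ENNReal.ofReal (ρ n ^ α) * (M2 + M2) +
        (volume (Metric.ball (0 : Euc N) (ρ n)))⁻¹ * I n p := by
    intro n p
    set v : Euc N → ℝ := fun x => f (φ p.1) x - f (φ p.2) x with hv
    have hvi : Integrable v := (hi _).sub (hi _)
    have hvm : Measurable v := (hm _).sub (hm _)
    have e1 : ∫⁻ x, ‖v x‖ₑ = ∫⁻ x in Ω, ‖v x‖ₑ := by
      rw [← lintegral_indicator hΩo.measurableSet]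
      apply lintegral_congr_ae
      filter_upwards [h0 (φ p.1) (φ p.2)] with x hx
      by_cases hxΩ : x ∈ Ω
      · rw [indicator_of_mem hxΩ]
      · rw [indicator_of_notMem hxΩ, hv]; simp [hx hxΩ]
    rw [e1]
    have hpt : ∀ x, ‖v x‖ₑ ≤ K * ENNReal.ofReal (ρ n ^ α) * gagG N α v x +
        (volume (Metric.ball (0 : Euc N) (ρ n)))⁻¹ *
          ‖a (φ p.1) (ι n x, n) - a (φ p.2) (ι n x, n)‖ₑ := by
      intro x
      have := hKe v hvi x _ _ (hιs n x)
      rw [hv, integral_sub (hi _).integrableOn (hi _).integrableOn] at this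
      exact this
    refine (lintegral_mono hpt).trans ?_
    rw [lintegral_add_left ((measurable_gagG N α hvm).const_mul _),
      lintegral_const_mul' _ _ (ENNReal.mul_ne_top hK ENNReal.ofReal_ne_top),
      lintegral_const_mul' _ _ (ENNReal.inv_ne_top.2 (Metric.measure_ball_pos _ _ (hρ0 n)).ne')]
    gcongr
    refine (setLIntegral_le_lintegral _ _).trans ((gagJ_sub_le N α (hm _)).trans ?_)
    exact add_le_add (hJ _) (hJ _)
  have hKρ : Tendsto (fun n => K * ENNReal.ofReal (ρ n ^ α) * (M2 + M2)) atTop (𝓝 0) := by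
    have h1 : Tendsto ρ atTop (𝓝 0) := tendsto_one_div_add_atTop_nhds_zero_nat
    have h2 : Tendsto (fun n => ρ n ^ α) atTop (𝓝 0) := by
      have := h1.rpow_const (p := α) (Or.inr hα.le)
      rwa [Real.zero_rpow hα.ne'] at this
    have h3 := ENNReal.tendsto_ofReal h2
    have h4 := ENNReal.Tendsto.const_mul (a := K) h3 (Or.inr hK)
    have h5 := ENNReal.Tendsto.mul_const (b := M2 + M2) h4 (Or.inr (ENNReal.add_ne_top.2 ⟨hM2, hM2⟩))
    simpa using h5
  rw [ENNReal.tendsto_nhds_zero] at hKρ ⊢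
  intro ε hε
  have hε2 : 0 < ε / 2 := ENNReal.half_pos hε.ne'
  obtain ⟨n, hn⟩ := (hKρ (ε / 2) hε2).exists
  have hIn := ENNReal.Tendsto.const_mul (a := (volume (Metric.ball (0 : Euc N) (ρ n)))⁻¹) (hI0 n)
    (Or.inr (ENNReal.inv_ne_top.2 (Metric.measure_ball_pos _ _ (hρ0 n)).ne'))
  rw [mul_zero, ENNReal.tendsto_nhds_zero] at hIn
  filter_upwards [hIn (ε / 2) hε2] with p hp
  refine (hbound n p).trans ?_
  rw [← ENNReal.add_halves ε]
  exact add_le_add hn hp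

lemma L1_cauchy_lim {N : ℕ} {f : ℕ → Euc N → ℝ} (hi : ∀ k, Integrable (f k))
    (h : Tendsto (fun p : ℕ × ℕ => ∫⁻ x, ‖f p.1 x - f p.2 x‖ₑ) (atTop ×ˢ atTop) (𝓝 0)) :
    ∃ g : Euc N → ℝ, Measurable g ∧ Integrable g ∧
      Tendsto (fun i => eLpNorm (fun x => f i x - g x) 1 volume) atTop (𝓝 0) := by
  set F : ℕ → Lp ℝ 1 (volume : Measure (Euc N)) := fun k => (hi k).toL1 (f k) with hF
  have hed : ∀ k l, edist (F k) (F l) = ∫⁻ x, ‖f k x - f l x‖ₑ := by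
    intro k l
    rw [hF, Integrable.edist_toL1_toL1]
    simp [edist_eq_enorm_sub]
  have hc : CauchySeq F := by
    rw [EMetric.cauchySeq_iff]
    intro ε hε
    rw [ENNReal.tendsto_nhds_zero] at h
    obtain ⟨δ, hδ0, hδ⟩ := exists_between hε
    have h1 := h δ hδ0
    rw [prod_atTop_atTop_eq, eventually_atTop] at h1
    obtain ⟨⟨n1, n2⟩, hn⟩ := h1
    refine ⟨max n1 n2, fun m hm n hn' => ?_⟩
    rw [hed]
    exact (hn (m, n) ⟨(le_max_left _ _).trans hm, (le_max_right _ _).trans hn'⟩).trans_lt hδ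
  obtain ⟨G, hG⟩ := cauchySeq_tendsto_of_complete hc
  have hGm := (Lp.aestronglyMeasurable G).aemeasurable
  refine ⟨hGm.mk G, hGm.measurable_mk, (L1.integrable_coeFn G).congr hGm.ae_eq_mk, ?_⟩
  rw [Lp.tendsto_Lp_iff_tendsto_eLpNorm'] at hG
  refine hG.congr fun i => eLpNorm_congr_ae ?_
  filter_upwards [(hi i).coeFn_toL1, hGm.ae_eq_mk] with x h1 h2
  simp only [Pi.sub_apply, hF, h1, ← h2]

lemma gagTV_lsc (N : ℕ) (hN : 1 ≤ N) {α : ℝ} (hα : α ∈ Ioo (0:ℝ) 1) {f : ℕ → Euc N → ℝ}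
    {g : Euc N → ℝ} (hi : ∀ k, Integrable (f k)) (hg : Integrable g)
    (h : Tendsto (fun i => eLpNorm (fun x => f i x - g x) 1 volume) atTop (𝓝 0))
    {T : ℕ → ℝ≥0∞} {L : ℝ≥0∞} (hT : ∀ i, gagTV N α (f i) ≤ T i) (hTL : Tendsto T atTop (𝓝 L)) :
    gagTV N α g ≤ L := by
  unfold gagTV
  refine iSup_le fun Φ => iSup_le fun h1 => iSup_le fun h2 => iSup_le fun h3 => ?_
  obtain ⟨C, hC⟩ := gagDiv_bounded N hN hα h1 h2
  have hm := gagDiv_measurable N α h1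
  have hint : ∀ u : Euc N → ℝ, Integrable u → Integrable (fun x => u x * gagDiv N α Φ x) := by
    intro u hu
    exact hu.mul_bdd (c := C) hm.aestronglyMeasurable (Eventually.of_forall hC)
  have hlim : Tendsto (fun i => ∫ x, f i x * gagDiv N α Φ x) atTop
      (𝓝 (∫ x, g x * gagDiv N α Φ x)) := by
    refine tendsto_integral_of_L1' _ (hint g hg).aestronglyMeasurable
      (Eventually.of_forall fun i => hint _ (hi i)) ?_
    have hb := ENNReal.Tendsto.const_mul (a := ENNReal.ofReal C) h (Or.inr ENNReal.ofReal_ne_top)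
    rw [mul_zero] at hb
    refine tendsto_of_tendsto_of_tendsto_of_le_of_le tendsto_const_nhds hb (fun _ => zero_le) ?_
    intro i
    simp only [eLpNorm_one_eq_lintegral_enorm]
    rw [← lintegral_const_mul' _ _ ENNReal.ofReal_ne_top]
    refine lintegral_mono fun x => ?_
    simp only [Pi.sub_apply]
    rw [← sub_mul, enorm_mul, mul_comm]
    gcongr
    rw [← ofReal_norm]
    exact ENNReal.ofReal_le_ofReal (hC x)
  refine le_of_tendsto_of_tendsto' (ENNReal.tendsto_ofReal hlim) hTL fun i => ?_
  refine le_trans ?_ (hT i)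
  unfold gagTV
  exact le_iSup_of_le Φ (le_iSup_of_le h1 (le_iSup_of_le h2 (le_iSup_of_le h3 le_rfl)))

/-- Compactness in the Gagliardo BV space with fixed exterior datum: a sequence in
`BV_G^α(Ω;u₀)` with uniformly bounded `L¹(Ω)`-norms and `TV_G^α`-energies has a limit
point `f ∈ BV_G^α(Ω;u₀)` with `TV_G^α(f) ≤ liminf TV_G^α(f_k)`, and a subsequence
converging to `f` in `L^p(ℝ^N)` for every `1 ≤ p < N/(N-α)`. -/
theorem compactness_BVGb
    (N : ℕ) (hN : 1 ≤ N) (α : ℝ) (hα : α ∈ Ioo (0:ℝ) 1)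
    (Ω : Set (Euc N)) (hΩo : IsOpen Ω) (hΩb : Bornology.IsBounded Ω)
    (u0 : Euc N → ℝ) (hu0 : MemBVG N α u0)
    (f : ℕ → Euc N → ℝ) (hf : ∀ k : ℕ, MemBVGb N α Ω u0 (f k))
    (hbd : (⨆ k : ℕ, eLpNorm (f k) 1 (volume.restrict Ω) + gagTV N α (f k)) < ⊤) :
    ∃ g : Euc N → ℝ, MemBVGb N α Ω u0 g ∧
      gagTV N α g ≤ atTop.liminf (fun k : ℕ => gagTV N α (f k)) ∧
      ∃ φ : ℕ → ℕ, StrictMono φ ∧ ∀ p : ℝ, 1 ≤ p → p < (N : ℝ) / ((N : ℝ) - α) →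
        Tendsto (fun i : ℕ =>
            eLpNorm (fun x => f (φ i) x - g x) (ENNReal.ofReal p) volume)
          atTop (𝓝 0) := by
  have hN0 : (1:ℝ) ≤ N := by exact_mod_cast hN
  set M := ⨆ k : ℕ, eLpNorm (f k) 1 (volume.restrict Ω) + gagTV N α (f k) with hM
  have hMt : M ≠ ⊤ := hbd.ne
  have hkM : ∀ k, eLpNorm (f k) 1 (volume.restrict Ω) + gagTV N α (f k) ≤ M := fun k =>
    le_iSup (fun k : ℕ => eLpNorm (f k) 1 (volume.restrict Ω) + gagTV N α (f k)) k
  have hTM : ∀ k, gagTV N α (f k) ≤ M := fun k => le_add_self.trans (hkM k)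
  have hLM : ∀ k, eLpNorm (f k) 1 (volume.restrict Ω) ≤ M := fun k => le_self_add.trans (hkM k)
  set L := atTop.liminf (fun k : ℕ => gagTV N α (f k)) with hL
  have hLt : L ≠ ⊤ := by
    have : L ≤ M := by
      refine (liminf_le_limsup).trans ?_
      exact limsup_le_of_le (by isBoundedDefault) (Eventually.of_forall hTM)
    exact (this.trans_lt hbd).ne
  have hfreq : ∀ n : ℕ, ∃ᶠ k in atTop, gagTV N α (f k) < L + ENNReal.ofReal (1 / ((n : ℝ) + 1)) := by
    intro n
    refine frequently_lt_of_liminf_lt (by isBoundedDefault) ?_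
    exact ENNReal.lt_add_right hLt (ENNReal.ofReal_pos.2 (by positivity)).ne'
  obtain ⟨φ0, hφ0, hTφ0⟩ := extraction_forall_of_frequently hfreq
  have ham : ∀ n, AEMeasurable (f (φ0 n)) := fun n =>
    (hf (φ0 n)).1.1.aestronglyMeasurable.aemeasurable
  set F : ℕ → Euc N → ℝ := fun n => (ham n).mk (f (φ0 n)) with hF
  have hFm : ∀ n, Measurable (F n) := fun n => (ham n).measurable_mk
  have hFe : ∀ n, f (φ0 n) =ᵐ[volume] F n := fun n => (ham n).ae_eq_mk
  have hFi : ∀ n, Integrable (F n) := fun n => (hf (φ0 n)).1.1.congr (hFe n)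
  have hFT : ∀ n, gagTV N α (F n) = gagTV N α (f (φ0 n)) := fun n =>
    (gagTV_congr N α (hFe n)).symm
  have hFu : ∀ n, ∀ᵐ x, x ∉ Ω → F n x = u0 x := by
    intro n
    filter_upwards [hFe n, (hf (φ0 n)).2] with x h1 h2 h3
    rw [← h1, h2 h3]
  have hFJ : ∀ n, ∫⁻ x, gagG N α (F n) x ≤ M := fun n =>
    (gag_J_le N hα.1 (hFm n) (hFi n)).trans ((hFT n).le.trans (hTM _))
  set M1 := M + ∫⁻ x, ‖u0 x‖ₑ with hM1
  have hM1t : M1 ≠ ⊤ := ENNReal.add_ne_top.2 ⟨hMt, hu0.1.2.ne⟩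
  have hF1 : ∀ n, ∫⁻ x, ‖F n x‖ₑ ≤ M1 := by
    intro n
    rw [← lintegral_add_compl _ hΩo.measurableSet]
    refine add_le_add ?_ ?_
    · rw [← eLpNorm_one_eq_lintegral_enorm,
        ← eLpNorm_congr_ae (ae_restrict_of_ae (hFe n))]
      exact hLM _
    · refine le_trans (le_of_eq ?_) (setLIntegral_le_lintegral Ωᶜ _)
      refine setLIntegral_congr_fun_ae hΩo.measurableSet.compl ?_
      filter_upwards [hFu n] with x hx hxΩ
      rw [hx hxΩ]
  have hF0 : ∀ k l, ∀ᵐ x, x ∉ Ω → F k x = F l x := by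
    intro k l
    filter_upwards [hFu k, hFu l] with x h1 h2 h3
    rw [h1 h3, h2 h3]
  obtain ⟨φ1, hφ1, hC⟩ := gag_compact N hN hα.1 hΩo hΩb hFm hFi hF0 hM1t hMt hF1 hFJ
  obtain ⟨g, hgm, hgi, hglim⟩ := L1_cauchy_lim (fun k => hFi (φ1 k)) hC
  have hgu : ∀ᵐ x, x ∉ Ω → g x = u0 x := by
    have h1 := tendstoInMeasure_of_tendsto_eLpNorm (p := 1) one_ne_zero
      (fun n => (hFi (φ1 n)).aestronglyMeasurable) hgi.aestronglyMeasurable hglim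
    obtain ⟨ns, -, hns⟩ := h1.exists_seq_tendsto_ae
    filter_upwards [hns, ae_all_iff.2 hFu] with x h2 h3 h4
    refine tendsto_nhds_unique h2 ?_
    simp only [fun n => h3 n h4]
    exact tendsto_const_nhds
  have hgT : gagTV N α g ≤ L := by
    refine gagTV_lsc N hN hα (fun k => hFi (φ1 k)) hgi hglim
      (T := fun i => L + ENNReal.ofReal (1 / ((φ1 i : ℝ) + 1))) ?_ ?_
    · intro i
      rw [hFT]
      exact (hTφ0 (φ1 i)).le
    · have h1 := (tendsto_one_div_add_atTop_nhds_zero_nat (𝕜 := ℝ)).comp hφ1.tendsto_atTop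
      have h2 := (ENNReal.tendsto_ofReal h1).const_add L
      simpa using h2
  refine ⟨g, ⟨⟨hgi, hgT.trans_lt hLt.lt_top⟩, hgu⟩, hgT, φ0 ∘ φ1, hφ0.comp hφ1, ?_⟩
  intro p hp1 hp
  have hgJ : ∫⁻ x, gagG N α g x ≤ L := (gag_J_le N hα.1 hgm hgi).trans hgT
  have hfin := gag_Lp N hN hα hΩo hΩb (v := fun i x => F (φ1 i) x - g x)
    (fun i => (hFi _).sub hgi) (M := M + L) (ENNReal.add_ne_top.2 ⟨hMt, hLt⟩)
    (fun i => (gagJ_sub_le N α (hFm _)).trans (add_le_add (hFJ _) hgJ))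
    (fun i => by
      filter_upwards [hFu (φ1 i), hgu] with x h1 h2 h3
      rw [h1 h3, h2 h3, sub_self]) hglim p hp1 hp
  refine hfin.congr fun i => eLpNorm_congr_ae ?_
  filter_upwards [hFe (φ1 i)] with x hx
  simp only [Function.comp_apply, hx]
end
end

section
/- Evolutionary compactness in the Gagliardo BV setting: Let N ≥ 1, α ∈ (0,1), Ω ⊂ ℝ^N a bounded open set, u_0 ∈ BV_G^α(ℝ^N), and 0 < T < ∞. Suppose u_n ∈ L^1_w(0,T;BV_G^α(Ω;u_0)) for all n ≥ 1, each with distributional time derivative ∂_t u_n ∈ L^1(ℝ^N×(0,T)), and sup_{n≥1} ( ∫_0^T TV_G^α(u_n(t);ℝ^N) dt + ‖∂_t u_n‖_{L^1(ℝ^N×(0,T))} + ‖u_n‖_{L^1(ℝ^N×(0,T))} ) < ∞. Then the sequence (u_n)_{n≥1} is precompact in L^1(ℝ^N×(0,T)). -/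
noncomputable section

open MeasureTheory Set Filter ENNReal
open scoped Topology

/-- `dv` is the distributional time derivative `∂ₜ v` of `v` in `ℝ^N × (0,T)`. -/
def IsTimeDerivG (N : ℕ) (T : ℝ) (v dv : ℝ → Euc N → ℝ) : Prop :=
  ∀ φ : ℝ × Euc N → ℝ, ContDiff ℝ (⊤ : ℕ∞) φ → HasCompactSupport φ →
    tsupport φ ⊆ (Ioo 0 T) ×ˢ (univ : Set (Euc N)) →
    ∫ p : ℝ × Euc N, v p.1 p.2 * deriv (fun s => φ (s, p.2)) p.1 ∂(cylMeas N T)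
      = - ∫ p : ℝ × Euc N, dv p.1 p.2 * φ p ∂(cylMeas N T)

lemma compact_of_cells {X ι : Type*} [MeasurableSpace X] (μ : Measure X)
    (u : ℕ → X → ℝ) (hu : ∀ n, Integrable (u n) μ) (M : ℝ≥0∞) (hMt : M < ⊤)
    (hM : ∀ n, ∫⁻ p, ‖u n p‖ₑ ∂μ ≤ M)
    (hcell : ∀ ε : ℝ, 0 < ε → ∃ (κ : X → ι) (F : Finset ι) (c : ℝ), 0 < c ∧
      (∀ i, MeasurableSet (κ ⁻¹' {i})) ∧ (∀ i ∈ F, μ (κ ⁻¹' {i}) = ENNReal.ofReal c) ∧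
      (∀ᵐ x ∂μ, κ x ∈ F) ∧ ∀ n, ∫⁻ p, ∫⁻ q in κ ⁻¹' {κ p}, ‖u n p - u n q‖ₑ ∂μ ∂μ
        ≤ ENNReal.ofReal c * ENNReal.ofReal ε)
    (φ : ℕ → ℕ) : ∃ ψ : ℕ → ℕ, StrictMono ψ ∧ ∃ w : X → ℝ, Integrable w μ ∧
      Tendsto (fun i => ∫⁻ p, ‖u (φ (ψ i)) p - w p‖ₑ ∂μ) atTop (𝓝 0) := by
  classical
  set V : ℕ → (X →₁[μ] ℝ) := fun n => (hu n).toL1 with hV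
  have htb : TotallyBounded (range V) := by
    rw [Metric.totallyBounded_iff]
    intro ε hε
    obtain ⟨κ, F, c, hc, hmeas, hcF, hF, hS⟩ := hcell (ε / 4) (by positivity)
    let s : (F → ℝ) → X → ℝ := fun a x => ∑ i : F, (κ ⁻¹' {(i : ι)}).indicator (fun _ => a i) x
    have hsi : ∀ a, Integrable (s a) μ := by
      intro a
      refine integrable_finsetSum _ fun i _ => ?_
      refine (integrable_indicator_iff (hmeas i)).2 (integrableOn_const ?_)
      rw [hcF i i.2]; exact ENNReal.ofReal_ne_top
    have hsv : ∀ a x (hx : κ x ∈ F), s a x = a ⟨κ x, hx⟩ := by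
      intro a x hx
      simp only [s]
      rw [Finset.sum_eq_single ⟨κ x, hx⟩]
      · simp
      · intro b _ hb
        rw [indicator_of_notMem]
        intro h
        exact hb (Subtype.ext (by simpa using h.symm))
      · simp
    let L : (F → ℝ) →ₗ[ℝ] (X →₁[μ] ℝ) :=
      { toFun := fun a => (hsi a).toL1
        map_add' := by
          intro a b
          rw [← Integrable.toL1_add]
          rw [Integrable.toL1_eq_toL1_iff]
          refine Eventually.of_forall fun x => ?_
          simp only [s, Pi.add_apply, ← Finset.sum_add_distrib]
          refine Finset.sum_congr rfl fun i _ => ?_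
          simp only [indicator]; split_ifs <;> simp
        map_smul' := by
          intro r a
          simp only [RingHom.id_apply]
          rw [← Integrable.toL1_smul]
          rw [Integrable.toL1_eq_toL1_iff]
          refine Eventually.of_forall fun x => ?_
          simp only [s, Finset.smul_sum]
          refine Finset.sum_congr rfl fun i _ => ?_
          simp only [indicator]; split_ifs <;> simp }
    have hLc : Continuous L := L.continuous_of_finiteDimensional
    have hKc : IsCompact (L '' Metric.closedBall 0 (M.toReal / c)) :=
      (isCompact_closedBall _ _).image hLc
    obtain ⟨t, ht, htc⟩ := Metric.totallyBounded_iff.1 hKc.totallyBounded (ε / 2) (by positivity)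
    refine ⟨t, ht, ?_⟩
    rintro _ ⟨n, rfl⟩
    let a : F → ℝ := fun i => (∫ q in κ ⁻¹' {(i : ι)}, u n q ∂μ) / c
    have ha : a ∈ Metric.closedBall (0 : F → ℝ) (M.toReal / c) := by
      rw [mem_closedBall_zero_iff, pi_norm_le_iff_of_nonneg (by positivity)]
      intro i
      simp only [a, norm_div, Real.norm_of_nonneg hc.le]
      refine div_le_div_of_nonneg_right ?_ hc.le
      refine (norm_integral_le_integral_norm _).trans ?_
      refine (setIntegral_le_integral (hu n).norm (Eventually.of_forall fun _ => norm_nonneg _)).trans ?_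
      rw [integral_norm_eq_lintegral_enorm (hu n).1]
      exact ENNReal.toReal_mono hMt.ne (hM n)
    have hdist : dist (V n) (L a) ≤ ε / 4 := by
      have hc0 : ENNReal.ofReal c ≠ 0 := by simpa using hc
      have hpt : ∀ᵐ p ∂μ, ENNReal.ofReal c * ‖u n p - s a p‖ₑ
          ≤ ∫⁻ q in κ ⁻¹' {κ p}, ‖u n p - u n q‖ₑ ∂μ := by
        filter_upwards [hF] with p hp
        rw [hsv a p hp]
        have hfin : μ (κ ⁻¹' {κ p}) ≠ ⊤ := by rw [hcF _ hp]; exact ENNReal.ofReal_ne_top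
        have e : ∫ q in κ ⁻¹' {κ p}, (u n p - u n q) ∂μ = c * (u n p - a ⟨κ p, hp⟩) := by
          have ic : Integrable (fun _ : X => u n p) (μ.restrict (κ ⁻¹' {κ p})) :=
            integrableOn_const hfin
          rw [integral_sub ic (hu n).integrableOn, setIntegral_const,
            Measure.real, hcF _ hp, ENNReal.toReal_ofReal hc.le]
          simp only [a, smul_eq_mul]
          field_simp
        have : ENNReal.ofReal c = ‖c‖ₑ := by
          rw [Real.enorm_eq_ofReal hc.le]
        rw [this, ← enorm_mul, ← e]
        exact enorm_integral_le_lintegral_enorm _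
      have hint : ∫⁻ p, ‖u n p - s a p‖ₑ ∂μ ≤ ENNReal.ofReal (ε / 4) := by
        have h1 := (lintegral_mono_ae hpt).trans (hS n)
        rw [lintegral_const_mul' _ _ ENNReal.ofReal_ne_top] at h1
        exact (ENNReal.mul_le_mul_iff_right hc0 ENNReal.ofReal_ne_top).1 h1
      have hed : edist (V n) (L a) = ∫⁻ p, ‖u n p - s a p‖ₑ ∂μ := by
        change edist ((hu n).toL1) ((hsi a).toL1) = _
        rw [Integrable.edist_toL1_toL1]
        simp_rw [edist_eq_enorm_sub]
      rw [dist_edist, hed]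
      exact ENNReal.toReal_le_of_le_ofReal (by positivity) hint
    have hLa := htc (mem_image_of_mem L ha)
    simp only [mem_iUnion, Metric.mem_ball] at hLa ⊢
    obtain ⟨y, hy, hyd⟩ := hLa
    refine ⟨y, hy, ?_⟩
    calc dist (V n) y ≤ dist (V n) (L a) + dist (L a) y := dist_triangle _ _ _
      _ < ε := by linarith
  have hcomp : IsCompact (closure (range V)) :=
    htb.closure.isCompact_of_isClosed isClosed_closure
  obtain ⟨w, -, ψ, hψ, hlim⟩ := hcomp.tendsto_subseq (x := fun i => V (φ i))
    (fun i => subset_closure ⟨φ i, rfl⟩)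
  refine ⟨ψ, hψ, w, L1.integrable_coeFn w, ?_⟩
  rw [tendsto_iff_edist_tendsto_0] at hlim
  refine hlim.congr fun i => ?_
  have : w = (L1.integrable_coeFn w).toL1 := (Integrable.toL1_coeFn w _).symm
  simp only [Function.comp]
  conv_lhs => rw [this]
  change edist ((hu _).toL1) _ = _
  rw [Integrable.edist_toL1_toL1]
  simp_rw [edist_eq_enorm_sub]

lemma cell_split {X Y ι₁ ι₂ : Type*} [MeasurableSpace X] [MeasurableSpace Y]
    (ν : Measure X) (ρ : Measure Y) [SFinite ν] [SFinite ρ] (κ₁ : X → ι₁) (κ₂ : Y → ι₂)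
    (h₁ : MeasurableSet {p : X × X | κ₁ p.1 = κ₁ p.2})
    (h₂ : MeasurableSet {p : Y × Y | κ₂ p.1 = κ₂ p.2})
    (v : X × Y → ℝ) (hv : Measurable v) (a b : ℝ≥0∞)
    (ha : ∀ t, ν {s | κ₁ t = κ₁ s} ≤ a) (hb : ∀ y, ρ {x | κ₂ x = κ₂ y} ≤ b) :
    ∫⁻ p, ∫⁻ q in {q | κ₁ p.1 = κ₁ q.1 ∧ κ₂ p.2 = κ₂ q.2}, ‖v p - v q‖ₑ ∂(ν.prod ρ) ∂(ν.prod ρ)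
      ≤ a * (∫⁻ t, ∫⁻ x, ∫⁻ y, {z : Y × Y | κ₂ z.1 = κ₂ z.2}.indicator
            (fun z => ‖v (t, z.1) - v (t, z.2)‖ₑ) (x, y) ∂ρ ∂ρ ∂ν)
        + b * (∫⁻ t, ∫⁻ s, ∫⁻ y, {z : X × X | κ₁ z.1 = κ₁ z.2}.indicator
            (fun z => ‖v (z.1, y) - v (z.2, y)‖ₑ) (t, s) ∂ρ ∂ν ∂ν) := by
  set A := {p : X × X | κ₁ p.1 = κ₁ p.2} with hA
  set B := {p : Y × Y | κ₂ p.1 = κ₂ p.2} with hB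
  set I₁ : X → X → ℝ≥0∞ := fun t s => A.indicator (fun _ => 1) (t, s) with hI₁
  set I₂ : Y → Y → ℝ≥0∞ := fun x y => B.indicator (fun _ => 1) (x, y) with hI₂
  set G : X → Y → Y → ℝ≥0∞ := fun t x y => I₂ x y * ‖v (t, x) - v (t, y)‖ₑ with hG
  set H : X → X → Y → ℝ≥0∞ := fun t s y => I₁ t s * ‖v (t, y) - v (s, y)‖ₑ with hH
  have mI₁ : Measurable (fun p : X × X => I₁ p.1 p.2) := measurable_const.indicator h₁
  have mI₂ : Measurable (fun p : Y × Y => I₂ p.1 p.2) := measurable_const.indicator h₂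
  have mG : Measurable (fun z : X × Y × Y => G z.1 z.2.1 z.2.2) := by
    refine (mI₂.comp measurable_snd).mul ?_
    exact ((hv.comp (by fun_prop)).sub (hv.comp (by fun_prop))).enorm
  have mH : Measurable (fun z : X × X × Y => H z.1 z.2.1 z.2.2) := by
    refine (mI₁.comp (measurable_fst.prodMk (measurable_fst.comp measurable_snd))).mul ?_
    exact ((hv.comp (by fun_prop)).sub (hv.comp (by fun_prop))).enorm
  have pt : ∀ p, ∫⁻ q in {q | κ₁ p.1 = κ₁ q.1 ∧ κ₂ p.2 = κ₂ q.2}, ‖v p - v q‖ₑ ∂(ν.prod ρ)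
      ≤ a * (∫⁻ y, G p.1 p.2 y ∂ρ) + ∫⁻ q, I₂ p.2 q.2 * H p.1 q.1 q.2 ∂(ν.prod ρ) := by
    intro p
    have mS : MeasurableSet {q : X × Y | κ₁ p.1 = κ₁ q.1 ∧ κ₂ p.2 = κ₂ q.2} := by
      have m1 : MeasurableSet {q : X × Y | κ₁ p.1 = κ₁ q.1} :=
        h₁.preimage (by fun_prop : Measurable fun q : X × Y => (p.1, q.1))
      have m2 : MeasurableSet {q : X × Y | κ₂ p.2 = κ₂ q.2} :=
        h₂.preimage (by fun_prop : Measurable fun q : X × Y => (p.2, q.2))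
      exact m1.inter m2
    rw [← lintegral_indicator mS]
    have mG1 : Measurable fun y => G p.1 p.2 y := mG.comp (by fun_prop : Measurable fun y : Y => (p.1, p.2, y))
    have mI1 : Measurable fun s => I₁ p.1 s := mI₁.comp (by fun_prop : Measurable fun s => (p.1, s))
    calc _ ≤ ∫⁻ q, (I₁ p.1 q.1 * G p.1 p.2 q.2 + I₂ p.2 q.2 * H p.1 q.1 q.2) ∂(ν.prod ρ) := by
          refine lintegral_mono fun q => ?_
          by_cases hq : q ∈ {q : X × Y | κ₁ p.1 = κ₁ q.1 ∧ κ₂ p.2 = κ₂ q.2}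
          swap
          · rw [indicator_of_notMem hq]; exact zero_le
          rw [indicator_of_mem hq]
          have e1 : I₁ p.1 q.1 = 1 := indicator_of_mem (show (p.1, q.1) ∈ A from hq.1) _
          have e2 : I₂ p.2 q.2 = 1 := indicator_of_mem (show (p.2, q.2) ∈ B from hq.2) _
          simp only [hG, hH, e1, e2, one_mul]
          have : v p - v q = (v (p.1, p.2) - v (p.1, q.2)) + (v (p.1, q.2) - v (q.1, q.2)) := by ring
          rw [this]
          exact enorm_add_le _ _
      _ = (∫⁻ q, I₁ p.1 q.1 * G p.1 p.2 q.2 ∂(ν.prod ρ)) + ∫⁻ q, I₂ p.2 q.2 * H p.1 q.1 q.2 ∂(ν.prod ρ) := by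
          refine lintegral_add_left ?_ _
          exact (mI1.comp measurable_fst).mul (mG1.comp measurable_snd)
      _ ≤ _ := by
          gcongr
          rw [lintegral_prod_mul mI1.aemeasurable mG1.aemeasurable]
          gcongr
          refine le_trans (le_of_eq ?_) (ha p.1)
          have m1 : MeasurableSet {s : X | κ₁ p.1 = κ₁ s} :=
            h₁.preimage (by fun_prop : Measurable fun s : X => (p.1, s))
          rw [← lintegral_indicator_one m1]
          rfl
  refine (lintegral_mono pt).trans ?_
  have mGi : Measurable (fun p : X × Y => ∫⁻ y, G p.1 p.2 y ∂ρ) := by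
    apply Measurable.lintegral_prod_right' (f := fun z : (X × Y) × Y => G z.1.1 z.1.2 z.2)
    exact mG.comp (by fun_prop : Measurable fun z : (X × Y) × Y => (z.1.1, z.1.2, z.2))
  have mHH : Measurable (fun z : (X × Y) × (X × Y) => I₂ z.1.2 z.2.2 * H z.1.1 z.2.1 z.2.2) :=
    (mI₂.comp (by fun_prop : Measurable fun z : (X × Y) × (X × Y) => (z.1.2, z.2.2))).mul
      (mH.comp (by fun_prop : Measurable fun z : (X × Y) × (X × Y) => (z.1.1, z.2.1, z.2.2)))
  rw [lintegral_add_left (mGi.const_mul a), lintegral_const_mul _ mGi]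
  refine add_le_add ?_ ?_
  · rw [lintegral_prod _ mGi.aemeasurable]
    refine mul_le_mul_right (lintegral_mono fun t => lintegral_mono fun x => lintegral_mono fun y => ?_) _
    simp only [hG, hI₂, indicator]
    split_ifs <;> simp
  · rw [lintegral_prod _ (Measurable.lintegral_prod_right' mHH).aemeasurable]
    have inner : ∀ t, ∫⁻ x, ∫⁻ q, I₂ x q.2 * H t q.1 q.2 ∂(ν.prod ρ) ∂ρ
        ≤ b * ∫⁻ s, ∫⁻ y, H t s y ∂ρ ∂ν := by
      intro t
      have mHt : Measurable (fun q : X × Y => H t q.1 q.2) :=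
        mH.comp (by fun_prop : Measurable fun q : X × Y => (t, q.1, q.2))
      rw [lintegral_lintegral_swap]
      · rw [← lintegral_prod (fun q : X × Y => H t q.1 q.2) mHt.aemeasurable,
          ← lintegral_const_mul _ mHt]
        refine lintegral_mono fun q => ?_
        have m2 : MeasurableSet {x : Y | κ₂ x = κ₂ q.2} :=
            h₂.preimage (by fun_prop : Measurable fun x : Y => (x, q.2))
        have m3 : Measurable fun x => I₂ x q.2 := mI₂.comp (by fun_prop : Measurable fun x : Y => (x, q.2))
        change ∫⁻ x, I₂ x q.2 * H t q.1 q.2 ∂ρ ≤ _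
        rw [lintegral_mul_const _ m3]
        gcongr
        refine le_trans (le_of_eq ?_) (hb q.2)
        rw [← lintegral_indicator_one m2]
        rfl
      · exact (mHH.comp (by fun_prop : Measurable fun z : Y × (X × Y) => ((t, z.1), z.2))).aemeasurable
    refine (lintegral_mono inner).trans ?_
    rw [lintegral_const_mul]
    · refine mul_le_mul_right (lintegral_mono fun t => lintegral_mono fun x => lintegral_mono fun y => ?_) _
      simp only [hH, hI₁, indicator]
      split_ifs <;> simp
    · apply Measurable.lintegral_prod_right' (f := fun z : X × X => ∫⁻ y, H z.1 z.2 y ∂ρ)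
      apply Measurable.lintegral_prod_right' (f := fun z : (X × X) × Y => H z.1.1 z.1.2 z.2)
      exact mH.comp (by fun_prop : Measurable fun z : (X × X) × Y => (z.1.1, z.1.2, z.2))

open scoped Convolution in
lemma dual_compact {E : Type*} [NormedAddCommGroup E] [NormedSpace ℝ E] [FiniteDimensional ℝ E]
    [MeasurableSpace E] [BorelSpace E] (μ : Measure E) [μ.IsAddHaarMeasure]
    (U : Set E) (hU : IsOpen U) (g : E → ℝ) (hgm : Measurable g) (hg : LocallyIntegrableOn g U μ)
    (C : ℝ≥0∞)
    (h : ∀ ψ : E → ℝ, ContDiff ℝ (⊤ : ℕ∞) ψ → HasCompactSupport ψ → tsupport ψ ⊆ U →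
      (∀ x, |ψ x| ≤ 1) → ENNReal.ofReal (∫ x, g x * ψ x ∂μ) ≤ C)
    (K : Set E) (hK : IsCompact K) (hKU : K ⊆ U) : ∫⁻ x in K, ‖g x‖ₑ ∂μ ≤ C := by
  obtain ⟨δ, hδ, hδU⟩ := hK.exists_cthickening_subset_open hU hKU
  set K' := Metric.cthickening δ K with hK'
  have hK'c : IsCompact K' := hK.cthickening
  have hgi : IntegrableOn g K' μ := hg.integrableOn_compact_subset hδU hK'c
  set s : E → ℝ := K.indicator (fun x => (SignType.sign (g x) : ℝ)) with hs
  have hsgn : Measurable (fun x => (SignType.sign (g x) : ℝ)) := by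
    have : (fun x => (SignType.sign (g x) : ℝ)) =
        fun x => if 0 < g x then (1:ℝ) else if g x < 0 then -1 else 0 := by
      ext x
      simp only [sign_apply]
      split_ifs <;> simp
    rw [this]
    refine Measurable.ite (measurableSet_lt measurable_const hgm) measurable_const
      (Measurable.ite (measurableSet_lt hgm measurable_const) measurable_const measurable_const)
  have hsm : Measurable s := hsgn.indicator hK.measurableSet
  have hs1 : ∀ x, |s x| ≤ 1 := by
    intro x
    simp only [hs, indicator]
    split_ifs
    · rcases lt_trichotomy (g x) 0 with h | h | h <;> simp [h]
    · simp
  have hsi : Integrable s μ := by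
    have : Integrable (K.indicator (fun _ => (1:ℝ))) μ :=
      (integrable_indicator_iff hK.measurableSet).2 (integrableOn_const hK.measure_lt_top.ne)
    refine this.mono hsm.aestronglyMeasurable (Eventually.of_forall fun x => ?_)
    by_cases hx : x ∈ K
    · simpa [hx] using hs1 x
    · simp [hs, hx]
  let r : ℕ → ℝ := fun n => δ / (n + 2)
  have hr : ∀ n, 0 < r n := fun n => by positivity
  let φ : ℕ → ContDiffBump (0 : E) := fun n => ⟨r n / 2, r n, by have := hr n; positivity, by have := hr n; linarith⟩
  have hφ0 : Tendsto (fun n => (φ n).rOut) atTop (𝓝 0) := by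
    have : Tendsto (fun n : ℕ => δ / ((n:ℝ) + 2)) atTop (𝓝 0) :=
      Tendsto.const_div_atTop (tendsto_atTop_add_const_right _ _ tendsto_natCast_atTop_atTop) _
    exact this
  have hconv := ContDiffBump.ae_convolution_tendsto_right_of_locallyIntegrable (μ := μ) (φ := φ)
    (K := 2) hφ0 (Eventually.of_forall fun n => by
      change r n ≤ 2 * (r n / 2); linarith) hsi.locallyIntegrable
  set ψ : ℕ → E → ℝ := fun n => ((φ n).normed μ ⋆[ContinuousLinearMap.lsmul ℝ ℝ, μ] s) with hψ
  have hψs : ∀ n, ContDiff ℝ (⊤ : ℕ∞) (ψ n) := fun n =>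
    HasCompactSupport.contDiff_convolution_left _ (φ n).hasCompactSupport_normed
      (φ n).contDiff_normed hsi.locallyIntegrable
  have hψ1 : ∀ n x, |ψ n x| ≤ 1 := by
    intro n x
    have := (φ n).dist_normed_convolution_le (μ := μ) (x₀ := x) (ε := 1) (g := s)
    have h2 := MeasureTheory.dist_convolution_le (μ := μ) (f := (φ n).normed μ) (g := s) (x₀ := x)
      (z₀ := 0) (ε := 1) (R := (φ n).rOut)
      zero_le_one (by rw [(φ n).support_normed_eq]) (φ n).nonneg_normed
      (φ n).integral_normed hsm.aestronglyMeasurable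
      (fun y _ => by simpa using hs1 y)
    simpa using h2
  have hsupp : ∀ n, Function.support (ψ n) ⊆ K' := by
    intro n x hx
    obtain ⟨a, ha, b, hb, rfl⟩ := support_convolution_subset _ hx
    rw [(φ n).support_normed_eq] at ha
    have hbK : b ∈ K := by
      by_contra hb'
      exact hb (by simp [hs, hb'])
    refine Metric.mem_cthickening_of_dist_le _ b _ _ hbK ?_
    have : ‖a‖ < r n := by simpa using ha
    have h2 : r n ≤ δ := by
      apply div_le_self hδ.le
      have : (0:ℝ) ≤ n := Nat.cast_nonneg n
      linarith
    simp [dist_eq_norm]; linarith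
  have htsupp : ∀ n, tsupport (ψ n) ⊆ K' := fun n => closure_minimal (hsupp n) Metric.isClosed_cthickening
  have hlim : Tendsto (fun n => ∫ x, g x * ψ n x ∂μ) atTop (𝓝 (∫ x, g x * s x ∂μ)) := by
    refine tendsto_integral_of_dominated_convergence (K'.indicator fun x => |g x|) ?_ ?_ ?_ ?_
    · exact fun n => (hgm.mul (hψs n).continuous.measurable).aestronglyMeasurable
    · exact (integrable_indicator_iff hK'c.measurableSet).2 hgi.abs
    · refine fun n => Eventually.of_forall fun x => ?_
      by_cases hx : x ∈ K'
      · simp only [hx, indicator_of_mem, norm_mul, Real.norm_eq_abs]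
        exact mul_le_of_le_one_right (abs_nonneg _) (hψ1 n x)
      · have : ψ n x = 0 := by
          by_contra h0; exact hx (hsupp n h0)
        simp [hx, this]
    · filter_upwards [hconv] with x hx
      exact hx.const_mul _
  have heq : ∫ x, g x * s x ∂μ = ∫ x in K, ‖g x‖ ∂μ := by
    rw [← integral_indicator hK.measurableSet]
    congr 1; ext x
    by_cases hx : x ∈ K
    · simp [hs, hx, mul_comm (g x), sign_mul_self]
    · simp [hs, hx]
  have hKK' : K ⊆ K' := Metric.self_subset_cthickening K
  rw [← ofReal_integral_norm_eq_lintegral_enorm (hgi.mono_set hKK'), ← heq]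
  exact le_of_tendsto (ENNReal.tendsto_ofReal hlim) (Eventually.of_forall fun n =>
    h _ (hψs n) (hK'c.of_isClosed_subset (isClosed_tsupport _) (htsupp n)) ((htsupp n).trans hδU) (hψ1 n))

lemma dual_open {E : Type*} [NormedAddCommGroup E] [NormedSpace ℝ E] [FiniteDimensional ℝ E]
    [MeasurableSpace E] [BorelSpace E] (μ : Measure E) [μ.IsAddHaarMeasure]
    (U : Set E) (hU : IsOpen U) (g : E → ℝ) (hgm : Measurable g) (hg : LocallyIntegrableOn g U μ)
    (C : ℝ≥0∞)
    (h : ∀ ψ : E → ℝ, ContDiff ℝ (⊤ : ℕ∞) ψ → HasCompactSupport ψ → tsupport ψ ⊆ U →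
      (∀ x, |ψ x| ≤ 1) → ENNReal.ofReal (∫ x, g x * ψ x ∂μ) ≤ C) : ∫⁻ x in U, ‖g x‖ₑ ∂μ ≤ C := by
  obtain ⟨F, hF, hFU, hFe, hFm⟩ := hU.exists_iUnion_isClosed
  have := FiniteDimensional.proper_real E
  have hUe : U = ⋃ n : ℕ, (F n ∩ Metric.closedBall 0 n) := by
    rw [← hFe, iUnion_inter_of_monotone hFm (fun a b hab => Metric.closedBall_subset_closedBall (by exact_mod_cast hab)),
      Metric.iUnion_closedBall_nat, inter_univ]
  rw [hUe, setLIntegral_iUnion_of_directed]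
  · refine iSup_le fun n => dual_compact μ U hU g hgm hg C h _ ?_ (inter_subset_left.trans (hFU n))
    exact (isCompact_closedBall _ _).inter_left (hF n)
  · refine directed_of_isDirected_le fun a b hab => ?_
    exact inter_subset_inter (hFm hab) (Metric.closedBall_subset_closedBall (by exact_mod_cast hab))

lemma locInt_fst {N : ℕ} (f : Euc N → ℝ) (hf : Integrable f volume) :
    LocallyIntegrable (fun p : Euc N × Euc N => f p.1) volume := by
  intro p
  refine ⟨univ ×ˢ Metric.ball p.2 1, prod_mem_nhds univ_mem (Metric.ball_mem_nhds _ one_pos), ?_⟩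
  rw [IntegrableOn, Measure.volume_eq_prod, ← Measure.prod_restrict, Measure.restrict_univ]
  have : IsFiniteMeasure ((volume : Measure (Euc N)).restrict (Metric.ball p.2 1)) :=
    ⟨by simpa using measure_ball_lt_top⟩
  exact hf.comp_fst _

lemma locInt_snd {N : ℕ} (f : Euc N → ℝ) (hf : Integrable f volume) :
    LocallyIntegrable (fun p : Euc N × Euc N => f p.2) volume := by
  intro p
  refine ⟨Metric.ball p.1 1 ×ˢ univ, prod_mem_nhds (Metric.ball_mem_nhds _ one_pos) univ_mem, ?_⟩
  rw [IntegrableOn, Measure.volume_eq_prod, ← Measure.prod_restrict, Measure.restrict_univ]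
  have : IsFiniteMeasure ((volume : Measure (Euc N)).restrict (Metric.ball p.1 1)) :=
    ⟨by simpa using measure_ball_lt_top⟩
  exact hf.comp_snd _

lemma gag_le {N : ℕ} {α : ℝ} (f : Euc N → ℝ) (hfm : Measurable f) (hf : Integrable f volume) :
    ∫⁻ p : Euc N × Euc N, ‖(f p.1 - f p.2) / ‖p.1 - p.2‖ ^ ((N : ℝ) + α)‖ₑ ≤ gagTV N α f := by
  have hHaar : (volume : Measure (Euc N × Euc N)).IsAddHaarMeasure := by
    rw [Measure.volume_eq_prod]; infer_instance
  set U : Set (Euc N × Euc N) := {p | p.1 ≠ p.2} with hUdef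
  have hU : IsOpen U := isOpen_ne_fun continuous_fst continuous_snd
  set k : Euc N × Euc N → ℝ := fun p => (‖p.1 - p.2‖ ^ ((N : ℝ) + α))⁻¹ with hk
  have hkc : ContinuousOn k U := by
    intro p hp
    have hp' : ‖p.1 - p.2‖ ≠ 0 := by simpa [sub_eq_zero, hUdef] using hp
    refine ContinuousAt.continuousWithinAt ?_
    refine ContinuousAt.inv₀ (ContinuousAt.rpow_const (by fun_prop) (Or.inl hp')) ?_
    exact (Real.rpow_pos_of_pos (lt_of_le_of_ne (norm_nonneg _) hp'.symm) _).ne'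
  have hkm : Measurable k := by
    simp only [hk]; fun_prop
  have hl : LocallyIntegrable (fun p : Euc N × Euc N => f p.1 - f p.2) volume :=
    (locInt_fst f hf).sub (locInt_snd f hf)
  have hlU : LocallyIntegrableOn (fun p : Euc N × Euc N => (f p.1 - f p.2) * k p) U volume :=
    (hl.locallyIntegrableOn U).mul_continuousOn hkc hU.isLocallyClosed
  have hfm2 : Measurable (fun p : Euc N × Euc N => (f p.1 - f p.2) * k p) :=
    ((hfm.comp measurable_fst).sub (hfm.comp measurable_snd)).mul hkm
  have key := dual_open volume U hU _ hfm2 hlU (gagTV N α f) ?_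
  · rw [← lintegral_indicator hU.measurableSet] at key
    refine le_trans (lintegral_mono fun p => ?_) key
    by_cases hp : p ∈ U
    · simp [hp, hk, div_eq_mul_inv]
    · have : p.1 = p.2 := by simpa [hUdef] using hp
      simp [this]
  intro Φ hΦ hΦc hΦU hΦ1
  have hΨc : Continuous (fun p => Φ p * k p) := by
    have h1 : ContinuousOn (fun p => Φ p * k p) U := hΦ.continuous.continuousOn.mul hkc
    refine h1.continuous_of_tsupport_subset hU ?_
    exact (closure_mono (Function.support_mul_subset_left _ _)).trans hΦU
  have hΨs : HasCompactSupport (fun p => Φ p * k p) := hΦc.mul_right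
  set Ψ := (fun p => Φ p * k p) with hΨ
  have hi1 : Integrable (fun p : Euc N × Euc N => f p.1 * Ψ p) volume :=
    (locInt_fst f hf).integrable_smul_right_of_hasCompactSupport hΨc hΨs
  have hi2 : Integrable (fun p : Euc N × Euc N => f p.2 * Ψ p) volume :=
    (locInt_snd f hf).integrable_smul_right_of_hasCompactSupport hΨc hΨs
  have hi2' : Integrable (fun p : Euc N × Euc N => f p.1 * Ψ p.swap) volume := by
    rw [Measure.volume_eq_prod] at hi2 ⊢
    exact hi2.swap
  have hks : ∀ x y, k (y, x) = k (x, y) := fun x y => by simp only [hk]; rw [norm_sub_rev]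
  have e1 : ∫ p : Euc N × Euc N, f p.1 * Ψ p.swap = ∫ p : Euc N × Euc N, f p.2 * Ψ p := by
    rw [Measure.volume_eq_prod]
    exact integral_prod_swap (μ := (volume : Measure (Euc N))) (ν := (volume : Measure (Euc N)))
      (fun p : Euc N × Euc N => f p.2 * Ψ p)
  have e2 : ∫ p : Euc N × Euc N, (f p.1 - f p.2) * k p * Φ p
      = ∫ x, f x * gagDiv N α (fun x y => - Φ (x, y)) x := by
    calc ∫ p : Euc N × Euc N, (f p.1 - f p.2) * k p * Φ p
        = ∫ p : Euc N × Euc N, f p.1 * Ψ p - f p.2 * Ψ p := by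
          congr 1; ext p; simp only [hΨ]; ring
      _ = ∫ p : Euc N × Euc N, f p.1 * Ψ p - f p.1 * Ψ p.swap := by
          rw [integral_sub hi1 hi2, integral_sub hi1 hi2', e1]
      _ = ∫ x, ∫ y, f x * Ψ (x, y) - f x * Ψ (y, x) := by
          have := hi1.sub hi2'
          rw [Measure.volume_eq_prod] at this ⊢
          exact integral_prod _ this
      _ = _ := by
          congr 1; ext x
          rw [gagDiv, ← integral_neg, ← integral_const_mul]
          congr 1; ext y
          simp only [hΨ, hks x y]
          simp only [hk, div_eq_mul_inv]
          ring
  rw [e2, gagTV]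
  refine le_iSup_of_le (fun x y => - Φ (x, y)) ?_
  refine le_iSup_of_le hΦ.neg ?_
  refine le_iSup_of_le ?_ ?_
  · exact hΦc.neg
  refine le_iSup_of_le ?_ le_rfl
  intro x y
  simpa using hΦ1 (x, y)

open scoped Convolution in
lemma time_shift {N : ℕ} {T : ℝ} (v : ℝ × Euc N → ℝ) (hvm : Measurable v)
    (hv : Integrable v volume) (M : ℝ≥0∞)
    (hφ : ∀ φ : ℝ × Euc N → ℝ, ContDiff ℝ (⊤ : ℕ∞) φ → HasCompactSupport φ →
      tsupport φ ⊆ (Ioo 0 T) ×ˢ (univ : Set (Euc N)) → ∀ C : ℝ, 0 ≤ C → (∀ p, |φ p| ≤ C) →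
      ENNReal.ofReal |∫ p : ℝ × Euc N, v p * deriv (fun s => φ (s, p.2)) p.1| ≤ ENNReal.ofReal C * M)
    (h : ℝ) :
    ∫⁻ p in {p : ℝ × Euc N | p.1 ∈ Ioo 0 T ∧ p.1 + h ∈ Ioo 0 T}, ‖v (p.1 + h, p.2) - v p‖ₑ
      ≤ ENNReal.ofReal |h| * M := by
  have hHaar : (volume : Measure (ℝ × Euc N)).IsAddHaarMeasure := by
    rw [Measure.volume_eq_prod]; infer_instance
  set U := {p : ℝ × Euc N | p.1 ∈ Ioo 0 T ∧ p.1 + h ∈ Ioo 0 T} with hUdef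
  have hU : IsOpen U := by
    have h1 : IsOpen {p : ℝ × Euc N | p.1 ∈ Ioo 0 T} := isOpen_Ioo.preimage continuous_fst
    have h2 : IsOpen {p : ℝ × Euc N | p.1 + h ∈ Ioo 0 T} :=
      isOpen_Ioo.preimage (by fun_prop : Continuous fun p : ℝ × Euc N => p.1 + h)
    exact h1.inter h2
  have hadd : ∀ p : ℝ × Euc N, (p.1 + h, p.2) = p + (h, 0) := fun p => by ext <;> simp
  have hvs : Integrable (fun p : ℝ × Euc N => v (p.1 + h, p.2)) volume := by
    simp_rw [hadd]
    exact hv.comp_add_right (h, (0 : Euc N))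
  have hvsm : Measurable (fun p : ℝ × Euc N => v (p.1 + h, p.2)) := hvm.comp (by fun_prop)
  refine dual_open volume U hU (fun p => v (p.1 + h, p.2) - v p) (hvsm.sub hvm)
    ((hvs.sub hv).locallyIntegrable.locallyIntegrableOn U) _ ?_
  intro ψ hψ hψc hψU hψ1
  set φ : ℝ × Euc N → ℝ := fun p => ∫ e in (0:ℝ)..h, ψ (p.1 - e, p.2) with hφdef
  have hψcont := hψ.continuous
  -- smoothness
  have hsm : ContDiff ℝ (⊤ : ℕ∞) φ := by
    set f : ℝ → ℝ := fun e => (Ioc 0 h).indicator (fun _ => (1:ℝ)) e - (Ioc h 0).indicator (fun _ => (1:ℝ)) e with hf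
    have hfi : Integrable f volume := by
      refine Integrable.sub ?_ ?_ <;>
      · exact (integrable_indicator_iff measurableSet_Ioc).2 (integrableOn_const (by simp))
    have hc := contDiffOn_convolution_right_with_param (𝕜 := ℝ) (n := ⊤) (f := f) (μ := volume)
      (ContinuousLinearMap.lsmul ℝ ℝ) (g := fun (x : Euc N) (s : ℝ) => ψ (s, x)) (s := univ)
      (k := Prod.fst '' tsupport ψ) isOpen_univ (hψc.isCompact.image continuous_fst)
      (by
        intro x s _ hs
        by_contra h0
        exact hs ⟨(s, x), subset_tsupport _ h0, rfl⟩)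
      hfi.locallyIntegrable
      (by
        have : ContDiff ℝ (⊤ : ℕ∞) (fun q : Euc N × ℝ => ψ (q.2, q.1)) := hψ.comp (by fun_prop)
        exact this.contDiffOn)
    rw [univ_prod_univ, contDiffOn_univ] at hc
    have hc2 : ContDiff ℝ (⊤ : ℕ∞) (fun p : ℝ × Euc N =>
      (f ⋆[ContinuousLinearMap.lsmul ℝ ℝ, volume] fun s => ψ (s, p.2)) p.1) :=
      hc.comp (by fun_prop : ContDiff ℝ (⊤ : ℕ∞) (fun p : ℝ × Euc N => (p.2, p.1)))
    convert hc2 using 1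
    ext p
    have hcont : Continuous (fun e => ψ (p.1 - e, p.2)) := by fun_prop
    rw [hφdef, convolution_def]
    simp only [ContinuousLinearMap.lsmul_apply, smul_eq_mul, hf, sub_mul]
    rw [intervalIntegral, integral_sub, ← integral_indicator measurableSet_Ioc,
      ← integral_indicator measurableSet_Ioc]
    · congr 1 <;>
      · congr 1; ext e; simp [indicator]
    all_goals
      have : ∀ a b : ℝ, Integrable (fun e => (Ioc a b).indicator (fun _ => (1:ℝ)) e * ψ (p.1 - e, p.2)) := by
        intro a b
        have h1 : IntegrableOn (fun e => ψ (p.1 - e, p.2)) (Ioc a b) :=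
          (hcont.integrableOn_Icc).mono_set Ioc_subset_Icc_self
        have h2 := (integrable_indicator_iff measurableSet_Ioc).2 h1
        exact h2.congr (Eventually.of_forall fun e => by simp [indicator])
      exact this _ _
  -- support
  set K : Set (ℝ × Euc N) := (fun q : (ℝ × Euc N) × ℝ => (q.1.1 + q.2, q.1.2)) '' (tsupport ψ ×ˢ uIcc 0 h) with hK
  have hKc : IsCompact K := (hψc.isCompact.prod isCompact_uIcc).image (by fun_prop)
  have hsK : Function.support φ ⊆ K := by
    intro p hp
    by_contra hpK
    apply hp
    have : ∀ e ∈ uIcc 0 h, ψ (p.1 - e, p.2) = 0 := by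
      intro e he
      by_contra h0
      exact hpK ⟨((p.1 - e, p.2), e), ⟨subset_tsupport _ h0, he⟩, by simp⟩
    simp only [hφdef]
    rw [intervalIntegral.integral_congr (g := fun _ => (0:ℝ)) this]
    simp
  have htK : tsupport φ ⊆ K := closure_minimal hsK hKc.isClosed
  have hKT : K ⊆ (Ioo 0 T) ×ˢ (univ : Set (Euc N)) := by
    rintro _ ⟨⟨q, e⟩, ⟨hq, he⟩, rfl⟩
    obtain ⟨⟨h1, h2⟩, h3, h4⟩ := hψU hq
    refine ⟨?_, mem_univ _⟩
    simp only [mem_Ioo]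
    rcases mem_uIcc.1 he with ⟨ha, hb⟩ | ⟨ha, hb⟩ <;> constructor <;> linarith
  have hb : ∀ p, |φ p| ≤ |h| := by
    intro p
    have := intervalIntegral.norm_integral_le_of_norm_le_const (a := 0) (b := h) (C := 1)
      (f := fun e => ψ (p.1 - e, p.2)) (fun e _ => hψ1 _)
    simpa using this
  have hd : ∀ p : ℝ × Euc N, deriv (fun s => φ (s, p.2)) p.1 = ψ p - ψ (p.1 - h, p.2) := by
    intro p
    have hcont : Continuous (fun r => ψ (r, p.2)) := by fun_prop
    have e : (fun s => φ (s, p.2)) = fun s => (∫ r in (0:ℝ)..s, ψ (r, p.2)) - ∫ r in (0:ℝ)..(s - h), ψ (r, p.2) := by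
      ext s
      simp only [hφdef]
      rw [intervalIntegral.integral_comp_sub_left (fun r => ψ (r, p.2)) s, sub_zero,
        intervalIntegral.integral_interval_sub_left (hcont.intervalIntegrable _ _) (hcont.intervalIntegrable _ _)]
    rw [e]
    have d1 : HasDerivAt (fun s => ∫ r in (0:ℝ)..s, ψ (r, p.2)) (ψ (p.1, p.2)) p.1 :=
      hcont.integral_hasStrictDerivAt 0 p.1 |>.hasDerivAt
    have d2 : HasDerivAt (fun s => ∫ r in (0:ℝ)..(s-h), ψ (r, p.2)) (ψ (p.1 - h, p.2)) p.1 := by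
      have := (hcont.integral_hasStrictDerivAt 0 (p.1 - h)).hasDerivAt
      exact this.comp_sub_const p.1 h
    exact (d1.sub d2).deriv
  have hmain := hφ φ hsm (hKc.of_isClosed_subset (isClosed_tsupport _) htK) (htK.trans hKT) |h| (abs_nonneg _) hb
  refine le_trans (ENNReal.ofReal_le_ofReal ?_) hmain
  obtain ⟨Cb, hCb⟩ : ∃ C, ∀ p, ‖ψ p‖ ≤ C := ⟨1, hψ1⟩
  have i1 : Integrable (fun p : ℝ × Euc N => v (p.1 + h, p.2) * ψ p) volume :=
    hvs.mul_bdd hψcont.aestronglyMeasurable (Eventually.of_forall hCb)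
  have i2 : Integrable (fun p : ℝ × Euc N => v p * ψ p) volume :=
    hv.mul_bdd hψcont.aestronglyMeasurable (Eventually.of_forall hCb)
  have i3 : Integrable (fun p : ℝ × Euc N => v p * ψ (p.1 - h, p.2)) volume :=
    hv.mul_bdd (by fun_prop : Continuous fun p : ℝ × Euc N => ψ (p.1 - h, p.2)).aestronglyMeasurable
      (Eventually.of_forall fun p => hCb _)
  have e3 : ∫ p : ℝ × Euc N, v (p.1 + h, p.2) * ψ p = ∫ p : ℝ × Euc N, v p * ψ (p.1 - h, p.2) := by
    rw [← integral_add_right_eq_self (fun p : ℝ × Euc N => v p * ψ (p.1 - h, p.2)) (h, 0)]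
    congr 1; ext p; simp [hadd]
  simp_rw [hd, sub_mul, mul_sub]
  rw [integral_sub i1 i2, integral_sub i2 i3, e3, abs_sub_comm]
  exact le_abs_self _

lemma floor_cell (m : ℝ) (hm : 0 < m) (k : ℤ) :
    {s : ℝ | ⌊m * s⌋ = k} = Ico (k / m) (k / m + 1 / m) := by
  ext s
  simp only [mem_ofPred_eq, Int.floor_eq_iff, mem_Ico]
  rw [div_le_iff₀ hm, ← add_div, lt_div_iff₀ hm, mul_comm]

lemma floor_close (m : ℝ) (hm : 0 < m) (s t : ℝ) (h : ⌊m * s⌋ = ⌊m * t⌋) : |s - t| ≤ 1 / m := by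
  have := Int.abs_sub_lt_one_of_floor_eq_floor h
  rw [← mul_sub, abs_mul, abs_of_pos hm] at this
  rw [le_div_iff₀ hm, mul_comm]; exact this.le

lemma euc_cell_volume {N : ℕ} (m : ℝ) (hm : 0 < m) (k : Fin N → ℤ) :
    volume {x : Euc N | (fun i => ⌊m * x i⌋) = k} = ENNReal.ofReal ((1 / m) ^ N) := by
  have hmp := EuclideanSpace.volume_preserving_symm_measurableEquiv_toLp (Fin N)
  have e : {x : Euc N | (fun i => ⌊m * x i⌋) = k} =
      (MeasurableEquiv.toLp 2 (Fin N → ℝ)).symm ⁻¹'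
        (Set.pi univ fun i => Ico ((k i : ℝ) / m) (k i / m + 1 / m)) := by
    ext x
    simp only [mem_ofPred_eq, funext_iff, mem_preimage, Set.mem_pi, mem_univ, true_imp_iff,
      ← floor_cell m hm]
    rfl
  rw [e, hmp.measure_preimage_equiv, Real.volume_pi_Ico]
  rw [ENNReal.ofReal_pow (by positivity)]
  simp

lemma euc_close {N : ℕ} (m : ℝ) (hm : 0 < m) (x y : Euc N)
    (h : (fun i => ⌊m * x i⌋) = fun i => ⌊m * y i⌋) : ‖x - y‖ ≤ √N / m := by
  rw [EuclideanSpace.norm_eq]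
  have : ∑ i, ‖(x - y) i‖ ^ 2 ≤ N * (1 / m) ^ 2 := by
    calc ∑ i, ‖(x - y) i‖ ^ 2 ≤ ∑ i : Fin N, (1 / m) ^ 2 := by
          refine Finset.sum_le_sum fun i _ => ?_
          gcongr
          exact floor_close m hm _ _ (congrFun h i)
      _ = _ := by simp
  refine (Real.sqrt_le_sqrt this).trans (le_of_eq ?_)
  rw [Real.sqrt_mul (Nat.cast_nonneg N), Real.sqrt_sq (by positivity)]
  ring

lemma space_cell {N : ℕ} {α : ℝ} (hα : 0 < α) (f : Euc N → ℝ) (hf : Measurable f)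
    (ρ : Measure (Euc N)) (hρ : ρ ≤ volume) (m : ℝ) (hm : 0 < m) :
    ∫⁻ x, ∫⁻ y, {z : Euc N × Euc N | (fun i => ⌊m * z.1 i⌋) = fun i => ⌊m * z.2 i⌋}.indicator
      (fun z => ‖f z.1 - f z.2‖ₑ) (x, y) ∂ρ ∂ρ ≤
    ENNReal.ofReal ((√N / m) ^ ((N : ℝ) + α)) *
      ∫⁻ p : Euc N × Euc N, ‖(f p.1 - f p.2) / ‖p.1 - p.2‖ ^ ((N : ℝ) + α)‖ₑ := by
  have mg : Measurable (fun p : Euc N × Euc N => ‖(f p.1 - f p.2) / ‖p.1 - p.2‖ ^ ((N : ℝ) + α)‖ₑ) := by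
    fun_prop
  rw [← lintegral_const_mul _ mg, Measure.volume_eq_prod, lintegral_prod _ (mg.const_mul _).aemeasurable]
  refine lintegral_mono' hρ fun x => lintegral_mono' hρ fun y => ?_
  simp only [indicator, mem_ofPred_eq]
  split_ifs with h
  swap
  · exact zero_le
  by_cases hxy : x = y
  · simp [hxy]
  have hpos : 0 < ‖x - y‖ := norm_pos_iff.2 (sub_ne_zero.2 hxy)
  have hN : 0 ≤ (N : ℝ) + α := by positivity
  have hr := Real.rpow_le_rpow hpos.le (euc_close m hm x y h) hN
  have hp2 := Real.rpow_pos_of_pos hpos ((N : ℝ) + α)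
  have e : ‖f x - f y‖ₑ = ENNReal.ofReal (‖x - y‖ ^ ((N : ℝ) + α)) *
      ‖(f x - f y) / ‖x - y‖ ^ ((N : ℝ) + α)‖ₑ := by
    rw [← Real.enorm_eq_ofReal hp2.le, ← enorm_mul]
    congr 1; field_simp
  rw [e]
  gcongr

lemma time_cell {N : ℕ} {T : ℝ} (v : ℝ × Euc N → ℝ) (hvm : Measurable v) (M : ℝ≥0∞)
    (hsh : ∀ h : ℝ, ∫⁻ p in {p : ℝ × Euc N | p.1 ∈ Ioo 0 T ∧ p.1 + h ∈ Ioo 0 T},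
      ‖v (p.1 + h, p.2) - v p‖ₑ ≤ ENNReal.ofReal |h| * M)
    (ρ : Measure (Euc N)) (hρ : ρ ≤ volume) (m : ℝ) (hm : 0 < m) :
    ∫⁻ t in Ioo 0 T, ∫⁻ s in Ioo 0 T, ∫⁻ y, {z : ℝ × ℝ | ⌊m * z.1⌋ = ⌊m * z.2⌋}.indicator
      (fun z => ‖v (z.1, y) - v (z.2, y)‖ₑ) (t, s) ∂ρ ≤
    ENNReal.ofReal (2 / m) * (ENNReal.ofReal (1 / m) * M) := by
  set δ := 1 / m with hδ
  have hδ0 : 0 < δ := by positivity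
  set Q : Set (ℝ × ℝ) := {z | z.1 ∈ Ioo 0 T ∧ z.2 ∈ Ioo 0 T ∧ z.2 - z.1 ∈ Icc (-δ) δ} with hQ
  have mQ : MeasurableSet Q := by
    refine (measurableSet_Ioo.preimage measurable_fst).inter
      ((measurableSet_Ioo.preimage measurable_snd).inter ?_)
    exact measurableSet_Icc.preimage (by fun_prop : Measurable fun z : ℝ × ℝ => z.2 - z.1)
  set J : ℝ × ℝ → ℝ≥0∞ := Q.indicator (fun z => ∫⁻ y, ‖v (z.2, y) - v (z.1, y)‖ₑ) with hJ
  have mJ : Measurable J := by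
    refine Measurable.indicator ?_ mQ
    apply Measurable.lintegral_prod_right' (f := fun w : (ℝ × ℝ) × Euc N => ‖v (w.1.2, w.2) - v (w.1.1, w.2)‖ₑ)
    exact ((hvm.comp (by fun_prop)).sub (hvm.comp (by fun_prop))).enorm
  calc _ ≤ ∫⁻ t, ∫⁻ s, J (t, s) := by
        rw [← lintegral_indicator measurableSet_Ioo]
        refine lintegral_mono fun t => ?_
        by_cases ht : t ∈ Ioo 0 T
        swap
        · simp only [indicator_of_notMem ht]; exact zero_le
        simp only [indicator_of_mem ht]
        rw [← lintegral_indicator measurableSet_Ioo]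
        refine lintegral_mono fun s => ?_
        by_cases hs : s ∈ Ioo 0 T
        swap
        · simp only [indicator_of_notMem hs]; exact zero_le
        simp only [indicator_of_mem hs]
        by_cases hk : ⌊m * t⌋ = ⌊m * s⌋
        · have hq : (t, s) ∈ Q := by
            refine ⟨ht, hs, ?_⟩
            have := floor_close m hm _ _ hk.symm
            exact abs_le.1 this
          rw [hJ, indicator_of_mem hq]
          refine lintegral_mono' hρ fun y => ?_
          simp only [indicator, mem_ofPred_eq, hk, if_true]
          rw [← enorm_neg, neg_sub]
        · simp [indicator, hk]
    _ = ∫⁻ t, ∫⁻ h, J (t, h + t) := by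
        congr 1; ext t
        exact (lintegral_add_right_eq_self (fun s => J (t, s)) t).symm
    _ = ∫⁻ h, ∫⁻ t, J (t, h + t) := by
        rw [lintegral_lintegral_swap]
        exact (mJ.comp (by fun_prop : Measurable fun z : ℝ × ℝ => (z.1, z.2 + z.1))).aemeasurable
    _ ≤ ∫⁻ h in Icc (-δ) δ, ENNReal.ofReal δ * M := by
        rw [← lintegral_indicator measurableSet_Icc]
        refine lintegral_mono fun h => ?_
        by_cases hh : h ∈ Icc (-δ) δ
        swap
        · have : ∀ t, J (t, h + t) = 0 := by
            intro t
            rw [hJ, indicator_of_notMem]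
            rintro ⟨-, -, h3⟩
            exact hh (by simpa using h3)
          simp [this]
        rw [indicator_of_mem hh]
        have h1 : ENNReal.ofReal |h| * M ≤ ENNReal.ofReal δ * M := by
          gcongr; exact abs_le.2 hh
        refine le_trans ?_ ((hsh h).trans h1)
        have mU : MeasurableSet {p : ℝ × Euc N | p.1 ∈ Ioo 0 T ∧ p.1 + h ∈ Ioo 0 T} :=
          (measurableSet_Ioo.preimage measurable_fst).inter
            (measurableSet_Ioo.preimage (by fun_prop : Measurable fun p : ℝ × Euc N => p.1 + h))
        rw [← lintegral_indicator mU, Measure.volume_eq_prod, lintegral_prod]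
        · refine lintegral_mono fun t => ?_
          simp only [hJ, indicator, hQ, mem_ofPred_eq]
          by_cases hc : t ∈ Ioo 0 T ∧ t + h ∈ Ioo 0 T
          · simp only [hc, if_true, add_comm h t]
            simp [hh.1, hh.2]
          · rw [if_neg]
            · exact zero_le
            · rintro ⟨h1, h2, -⟩
              exact hc ⟨h1, by rwa [add_comm]⟩
        · refine (Measurable.indicator ?_ mU).aemeasurable
          exact ((hvm.comp (by fun_prop)).sub hvm).enorm
    _ = _ := by
        rw [lintegral_const, Measure.restrict_apply MeasurableSet.univ, univ_inter, Real.volume_Icc,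
          mul_comm]
        congr 2
        rw [hδ]; ring

lemma good_rep {N : ℕ} {α : ℝ} {Ω : Set (Euc N)} (hΩ : MeasurableSet Ω) {u0 u0' : Euc N → ℝ}
    (hu0m : Measurable u0') (hu0 : ∀ᵐ x ∂(volume : Measure (Euc N)), u0 x = u0' x) {T : ℝ}
    (u du : ℝ → Euc N → ℝ) (hmem : MemL1wBVG N α Ω u0 T u) (hder : IsTimeDerivG N T u du)
    (M : ℝ≥0∞)
    (hbd : (∫⁻ t in Ioo (0:ℝ) T, gagTV N α (u t)) +
        eLpNorm (fun p : ℝ × Euc N => du p.1 p.2) 1 (cylMeas N T) +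
        eLpNorm (fun p : ℝ × Euc N => u p.1 p.2) 1 (cylMeas N T) ≤ M) :
    ∃ v : ℝ × Euc N → ℝ, Measurable v ∧ Integrable v volume ∧
      (∀ᵐ p ∂(cylMeas N T), v p = u p.1 p.2) ∧ ∫⁻ p, ‖v p‖ₑ ≤ M ∧
      (∫⁻ t in Ioo 0 T, ∫⁻ p : Euc N × Euc N,
        ‖(v (t, p.1) - v (t, p.2)) / ‖p.1 - p.2‖ ^ ((N : ℝ) + α)‖ₑ ≤ M) ∧
      (∀ h : ℝ, ∫⁻ p in {p : ℝ × Euc N | p.1 ∈ Ioo 0 T ∧ p.1 + h ∈ Ioo 0 T},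
        ‖v (p.1 + h, p.2) - v p‖ₑ ≤ ENNReal.ofReal |h| * M) ∧
      (∀ᵐ p ∂(cylMeas N T), p.2 ∉ Ω → v p = u0' p.2) := by
  obtain ⟨hI, -, hB, -⟩ := hmem
  have hM1 : ∫⁻ t in Ioo (0:ℝ) T, gagTV N α (u t) ≤ M :=
    le_trans (le_trans le_self_add le_self_add) hbd
  have hM2 : eLpNorm (fun p : ℝ × Euc N => du p.1 p.2) 1 (cylMeas N T) ≤ M :=
    le_trans (le_trans le_add_self le_self_add) hbd
  have hM3 : eLpNorm (fun p : ℝ × Euc N => u p.1 p.2) 1 (cylMeas N T) ≤ M :=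
    le_trans le_add_self hbd
  rw [eLpNorm_one_eq_lintegral_enorm] at hM2 hM3
  set S : Set (ℝ × Euc N) := Ioo 0 T ×ˢ univ with hS
  have mS : MeasurableSet S := measurableSet_Ioo.prod MeasurableSet.univ
  have hcyl : cylMeas N T = volume.restrict S := by
    rw [cylMeas, Measure.volume_eq_prod, hS, ← Measure.prod_restrict, Measure.restrict_univ]
  set g := hI.1.mk _ with hg
  have hgm : Measurable g := hI.1.stronglyMeasurable_mk.measurable
  have hgu : ∀ᵐ p ∂(cylMeas N T), u p.1 p.2 = g p := hI.1.ae_eq_mk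
  set v := S.indicator g with hv
  have hvm : Measurable v := hgm.indicator mS
  have hvg : ∀ᵐ p ∂(cylMeas N T), v p = g p := by
    rw [hcyl]
    filter_upwards [ae_restrict_mem mS] with p hp
    exact indicator_of_mem hp _
  have hvu : ∀ᵐ p ∂(cylMeas N T), v p = u p.1 p.2 := by
    filter_upwards [hgu, hvg] with p h1 h2
    rw [h1, h2]
  have hvi : Integrable v volume := by
    rw [hv, integrable_indicator_iff mS, IntegrableOn, ← hcyl]
    exact hI.congr hgu
  have hvt : ∀ᵐ t ∂(volume.restrict (Ioo (0:ℝ) T)), ∀ᵐ x ∂(volume : Measure (Euc N)), v (t, x) = u t x :=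
    Measure.ae_ae_of_ae_prod hvu
  refine ⟨v, hvm, hvi, hvu, ?_, ?_, ?_, ?_⟩
  · refine le_trans (le_of_eq ?_) hM3
    have : ∀ p, ‖v p‖ₑ = S.indicator (fun p => ‖g p‖ₑ) p := by
      intro p; simp only [hv, indicator]; split_ifs <;> simp
    simp_rw [this]
    rw [lintegral_indicator mS, ← hcyl]
    refine lintegral_congr_ae ?_
    filter_upwards [hgu] with p hp
    rw [hp]
  · refine le_trans (lintegral_mono_ae ?_) hM1
    filter_upwards [hvt, hB] with t ht hBt
    have hint : Integrable (fun x => v (t, x)) volume :=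
      hBt.1.1.congr (by filter_upwards [ht] with x hx; rw [hx])
    have e : gagTV N α (u t) = gagTV N α (fun x => v (t, x)) := by
      unfold gagTV
      congr 1; ext Φ; congr 1; ext _; congr 1; ext _; congr 1; ext _
      congr 1
      refine integral_congr_ae ?_
      filter_upwards [ht] with x hx
      rw [hx]
    rw [e]
    exact gag_le _ (hvm.comp (by fun_prop : Measurable fun x => (t, x))) hint
  · refine time_shift v hvm hvi M ?_
    intro φ hφ hφc hφT C hC hφC
    have e : ∫ p : ℝ × Euc N, v p * deriv (fun s => φ (s, p.2)) p.1
        = - ∫ p : ℝ × Euc N, du p.1 p.2 * φ p ∂(cylMeas N T) := by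
      rw [← hder φ hφ hφc hφT]
      calc _ = ∫ p in S, v p * deriv (fun s => φ (s, p.2)) p.1 := by
            refine (setIntegral_eq_integral_of_forall_compl_eq_zero fun p hp => ?_).symm
            simp [hv, hp]
        _ = _ := by
            rw [← hcyl]
            refine integral_congr_ae ?_
            filter_upwards [hvu] with p hp
            rw [hp]
    rw [e, abs_neg, ← Real.norm_eq_abs, ofReal_norm_eq_enorm]
    refine (enorm_integral_le_lintegral_enorm _).trans ?_
    calc _ ≤ ∫⁻ p, ENNReal.ofReal C * ‖du p.1 p.2‖ₑ ∂(cylMeas N T) := by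
          refine lintegral_mono fun p => ?_
          rw [enorm_mul, mul_comm]
          gcongr
          rw [← ofReal_norm_eq_enorm]
          exact ENNReal.ofReal_le_ofReal (hφC p)
      _ ≤ _ := by
          rw [lintegral_const_mul' _ _ ENNReal.ofReal_ne_top]
          gcongr
  · have ms : MeasurableSet {p : ℝ × Euc N | p.2 ∉ Ω → v p = u0' p.2} := by
      have : {p : ℝ × Euc N | p.2 ∉ Ω → v p = u0' p.2} = Prod.snd ⁻¹' Ω ∪ {p | v p = u0' p.2} := by
        ext p; simp [or_iff_not_imp_left]
      rw [this]
      exact (hΩ.preimage measurable_snd).union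
        (measurableSet_eq_fun hvm (hu0m.comp measurable_snd))
    have := (Measure.ae_prod_iff_ae_ae (μ := volume.restrict (Ioo (0:ℝ) T))
      (ν := (volume : Measure (Euc N))) ms).2 ?_
    · exact this
    · filter_upwards [hvt, hB] with t ht hBt
      filter_upwards [ht, hBt.2, hu0] with x h1 h2 h3 hx
      rw [h1, h2 hx, h3]

lemma small_m (N : ℕ) {α : ℝ} (hα : 0 < α) (T : ℝ) (hT : 0 < T) (M : ℝ) (ε : ℝ) (hε : 0 < ε) :
    ∃ m : ℕ, 0 < m ∧ (T / m) * ((√N / m) ^ ((N : ℝ) + α) * M) +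
      (1 / (m:ℝ)) ^ N * (2 * (T / m) * (T / m * M)) ≤ T / m * (1 / (m:ℝ)) ^ N * ε := by
  have h1 : Tendsto (fun m : ℕ => (√N) ^ ((N : ℝ) + α) * (m : ℝ) ^ (-α) * M + 2 * (T / m) * M) atTop
      (𝓝 ((√N) ^ ((N : ℝ) + α) * 0 * M + 2 * 0 * M)) := by
    refine Tendsto.add ?_ ?_
    · exact (((tendsto_rpow_neg_atTop hα).comp tendsto_natCast_atTop_atTop).const_mul _).mul_const _
    · exact ((tendsto_const_div_atTop_nhds_zero_nat T).const_mul _).mul_const _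
  have h0 : (√N) ^ ((N : ℝ) + α) * 0 * M + 2 * 0 * M = 0 := by ring
  rw [h0] at h1
  obtain ⟨m, hm, hm0⟩ := ((h1.eventually (ge_mem_nhds hε)).and (eventually_gt_atTop 0)).exists
  refine ⟨m, hm0, ?_⟩
  have hmp : (0:ℝ) < m := by exact_mod_cast hm0
  have e : (√N / m) ^ ((N : ℝ) + α) = (1 / (m:ℝ)) ^ N * ((√N) ^ ((N : ℝ) + α) * (m : ℝ) ^ (-α)) := by
    rw [Real.div_rpow (Real.sqrt_nonneg _) hmp.le, Real.rpow_add hmp, Real.rpow_neg hmp.le,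
      Real.rpow_natCast]
    have := Real.rpow_pos_of_pos hmp α
    rw [one_div, inv_pow]
    field_simp
  rw [e]
  calc _ = T / m * (1 / (m:ℝ)) ^ N * ((√N) ^ ((N : ℝ) + α) * (m : ℝ) ^ (-α) * M + 2 * (T / m) * M) := by ring
    _ ≤ _ := by
      gcongr

theorem compactness_L1wBVG
    (N : ℕ) (hN : 1 ≤ N) (α : ℝ) (hα : α ∈ Ioo (0:ℝ) 1)
    (Ω : Set (Euc N)) (hΩo : IsOpen Ω) (hΩb : Bornology.IsBounded Ω)
    (u0 : Euc N → ℝ) (hu0 : MemBVG N α u0) (T : ℝ) (hT : 0 < T)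
    (un dun : ℕ → ℝ → Euc N → ℝ)
    (hmem : ∀ n : ℕ, MemL1wBVG N α Ω u0 T (un n))
    (hder : ∀ n : ℕ, IsTimeDerivG N T (un n) (dun n))
    (hbd : ∃ M : ℝ≥0∞, M < ⊤ ∧ ∀ n : ℕ,
      (∫⁻ t in Ioo (0:ℝ) T, gagTV N α (un n t)) +
        eLpNorm (fun p : ℝ × Euc N => dun n p.1 p.2) 1 (cylMeas N T) +
        eLpNorm (fun p : ℝ × Euc N => un n p.1 p.2) 1 (cylMeas N T) ≤ M) :
    ∀ φ : ℕ → ℕ, StrictMono φ → ∃ ψ : ℕ → ℕ, StrictMono ψ ∧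
      ∃ w : ℝ → Euc N → ℝ,
        Integrable (fun p : ℝ × Euc N => w p.1 p.2) (cylMeas N T) ∧
        Tendsto (fun i : ℕ =>
            eLpNorm (fun p : ℝ × Euc N => un (φ (ψ i)) p.1 p.2 - w p.1 p.2) 1
              (cylMeas N T))
          atTop (𝓝 0) := by
  intro φ _
  obtain ⟨M, hMt, hM⟩ := hbd
  set u0' := hu0.1.1.mk _ with hu0'
  have hu0m : Measurable u0' := hu0.1.1.stronglyMeasurable_mk.measurable
  have hu0e : ∀ᵐ x ∂(volume : Measure (Euc N)), u0 x = u0' x := hu0.1.1.ae_eq_mk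
  have hu0i : Integrable u0' volume := hu0.1.congr hu0e
  choose v hvm hvi hvu hvM hvG hvT hvΩ using fun n =>
    good_rep hΩo.measurableSet hu0m hu0e (un n) (dun n) (hmem n) (hder n) M (hM n)
  obtain ⟨R, hR⟩ : ∃ R : ℕ, ∀ x ∈ Ω, ‖x‖ < R := by
    obtain ⟨r, hr⟩ := hΩb.exists_norm_le
    obtain ⟨R, hR⟩ := exists_nat_gt r
    exact ⟨R, fun x hx => (hr x hx).trans_lt hR⟩
  set B : Set (Euc N) := {x | ∀ i, x i ∈ Ico (-(R:ℝ)) R} with hB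
  have mB : MeasurableSet B := by
    have : B = ⋂ i, {x : Euc N | x i ∈ Ico (-(R:ℝ)) R} := by ext; simp [hB]
    rw [this]
    exact MeasurableSet.iInter fun i => measurableSet_Ico.preimage (by fun_prop)
  have hΩB : Ω ⊆ B := by
    intro x hx i
    have h1 : ‖x i‖ ≤ ‖x‖ := PiLp.norm_apply_le x i
    have h2 := abs_lt.1 (lt_of_le_of_lt h1 (hR x hx))
    exact ⟨h2.1.le, h2.2⟩
  set ν : Measure ℝ := volume.restrict (Ioo 0 T) with hν
  set ρ : Measure (Euc N) := volume.restrict B with hρ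
  have hμ : ν.prod ρ = (cylMeas N T).restrict (univ ×ˢ B) := by
    rw [cylMeas, ← Measure.prod_restrict, Measure.restrict_univ]
  have hμle : ν.prod ρ ≤ volume := by
    rw [hμ, cylMeas]
    refine Measure.restrict_le_self.trans ?_
    have : (volume.restrict (Ioo 0 T)).prod (volume : Measure (Euc N)) =
        (volume : Measure (ℝ × Euc N)).restrict (Ioo 0 T ×ˢ univ) := by
      rw [Measure.volume_eq_prod, ← Measure.prod_restrict, Measure.restrict_univ]
    rw [this]
    exact Measure.restrict_le_self
  have mW : MeasurableSet ((univ : Set ℝ) ×ˢ B) := MeasurableSet.univ.prod mB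
  have key := compact_of_cells (ι := ℤ × (Fin N → ℤ)) (ν.prod ρ) v
    (fun n => (hvi n).mono_measure hμle) M hMt
    (fun n => (lintegral_mono' hμle le_rfl).trans (hvM n))
  refine Exists.elim (key ?_ φ) ?_
  rotate_left
  · rintro ψ ⟨hψ, W, hWi, hW⟩
    refine ⟨ψ, hψ, fun t x => (univ ×ˢ B).indicator W (t, x) +
      (univ ×ˢ B)ᶜ.indicator (fun p => u0' p.2) (t, x), ?_, ?_⟩
    · refine Integrable.add ?_ ?_
      · refine (integrable_indicator_iff mW).2 ?_
        rw [IntegrableOn, ← hμ]; exact hWi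
      · refine Integrable.indicator ?_ mW.compl
        rw [cylMeas]
        exact hu0i.comp_snd _
    · refine hW.congr fun i => ?_
      rw [eLpNorm_one_eq_lintegral_enorm, hμ, ← lintegral_indicator mW]
      refine lintegral_congr_ae ?_
      filter_upwards [hvu (φ (ψ i)), hvΩ (φ (ψ i))] with p h1 h2
      by_cases hp : p ∈ (univ : Set ℝ) ×ˢ B
      · rw [indicator_of_mem hp, indicator_of_mem (show (p.1, p.2) ∈ ((univ : Set ℝ) ×ˢ B) from hp),
          indicator_of_notMem (show (p.1, p.2) ∉ ((univ : Set ℝ) ×ˢ B)ᶜ from fun h => h hp), ← h1, add_zero]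
      · rw [indicator_of_notMem hp, indicator_of_notMem (show (p.1, p.2) ∉ ((univ : Set ℝ) ×ˢ B) from hp),
          indicator_of_mem (show (p.1, p.2) ∈ ((univ : Set ℝ) ×ˢ B)ᶜ from hp), ← h1, h2 (fun h => hp ⟨mem_univ _, hΩB h⟩)]
        simp
  intro ε hε
  obtain ⟨m, hm, hmε⟩ := small_m N hα.1 T hT M.toReal ε hε
  have hmp : (0:ℝ) < m := by exact_mod_cast hm
  have hmT : 0 < m / T := by positivity
  have hmTi : 1 / (m / T) = T / m := by field_simp
  set κ₁ : ℝ → ℤ := fun t => ⌊m / T * t⌋ with hκ₁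
  set κ₂ : Euc N → (Fin N → ℤ) := fun x i => ⌊(m:ℝ) * x i⌋ with hκ₂
  have mκ₁ : Measurable κ₁ := by
    refine Int.measurable_floor.comp ?_
    fun_prop
  have mκ₂ : Measurable κ₂ := by
    refine measurable_pi_lambda _ fun i => Int.measurable_floor.comp ?_
    fun_prop
  have hvol₁ : ∀ k : ℤ, volume (κ₁ ⁻¹' {k}) = ENNReal.ofReal (T / m) := by
    intro k
    have : κ₁ ⁻¹' {k} = _ := floor_cell (m / T) hmT k
    rw [this, Real.volume_Ico, hmTi]
    congr 1; ring
  have hvol₂ : ∀ k, volume (κ₂ ⁻¹' {k}) = ENNReal.ofReal ((1 / (m:ℝ)) ^ N) := by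
    intro k
    exact euc_cell_volume (m:ℝ) hmp k
  refine ⟨fun p => (κ₁ p.1, κ₂ p.2), Finset.Ico 0 (m:ℤ) ×ˢ
    Fintype.piFinset (fun _ => Finset.Ico (-((m:ℤ) * R)) (m * R)), T / m * (1 / (m:ℝ)) ^ N,
    by positivity, ?_, ?_, ?_, ?_⟩
  · intro i
    exact (measurableSet_singleton i).preimage
      ((mκ₁.comp measurable_fst).prodMk (mκ₂.comp measurable_snd))
  · rintro ⟨i, j⟩ hij
    obtain ⟨hi, hj⟩ := Finset.mem_product.1 hij
    simp only [Finset.mem_Ico, Fintype.mem_piFinset] at hi hj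
    have e : (fun p : ℝ × Euc N => (κ₁ p.1, κ₂ p.2)) ⁻¹' {(i, j)} = (κ₁ ⁻¹' {i}) ×ˢ (κ₂ ⁻¹' {j}) := by
      ext p; simp
    have e1 : ν (κ₁ ⁻¹' {i}) = ENNReal.ofReal (T / m) := by
      rw [hν, Measure.restrict_congr_set Ioo_ae_eq_Ico, Measure.restrict_apply (mκ₁ (measurableSet_singleton _)),
        inter_eq_left.2, hvol₁]
      intro t ht
      have ht' : ⌊m / T * t⌋ = i := ht
      obtain ⟨a1, a2⟩ := Int.floor_eq_iff.1 ht'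
      have b1 : (0:ℝ) ≤ i := by exact_mod_cast hi.1
      have b2 : (i:ℝ) + 1 ≤ m := by exact_mod_cast hi.2
      have c1 : 0 ≤ m / T * t := b1.trans a1
      have c2 : m / T * t < m := lt_of_lt_of_le a2 b2
      refine ⟨nonneg_of_mul_nonneg_right c1 hmT, ?_⟩
      have : m / T * t < m / T * T := by
        rw [div_mul_cancel₀ _ hT.ne']; exact c2
      exact lt_of_mul_lt_mul_left this hmT.le
    have e2 : ρ (κ₂ ⁻¹' {j}) = ENNReal.ofReal ((1 / (m:ℝ)) ^ N) := by
      rw [hρ, Measure.restrict_apply (mκ₂ (measurableSet_singleton _)), inter_eq_left.2, hvol₂]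
      intro x hx l
      have hx' : ⌊(m:ℝ) * x l⌋ = j l := congrFun hx l
      obtain ⟨a1, a2⟩ := Int.floor_eq_iff.1 hx'
      have b1 : -((m:ℝ) * R) ≤ j l := by exact_mod_cast (hj l).1
      have b2 : (j l:ℝ) + 1 ≤ m * R := by exact_mod_cast (hj l).2
      constructor
      · refine le_of_mul_le_mul_left ?_ hmp
        linarith
      · refine lt_of_mul_lt_mul_left ?_ hmp.le
        linarith
    rw [e, Measure.prod_prod, e1, e2, ← ENNReal.ofReal_mul (by positivity)]
  · have h1 : ∀ᵐ p ∂(ν.prod ρ), p ∈ Ioo 0 T ×ˢ B := by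
      rw [hν, hρ, Measure.prod_restrict]
      exact ae_restrict_mem (measurableSet_Ioo.prod mB)
    filter_upwards [h1] with p hp
    obtain ⟨ht, hx⟩ := hp
    simp only [Finset.mem_product, Finset.mem_Ico, Fintype.mem_piFinset, hκ₁, hκ₂]
    refine ⟨⟨Int.floor_nonneg.2 (by have := ht.1; positivity), Int.floor_lt.2 ?_⟩, fun l => ⟨Int.le_floor.2 ?_, Int.floor_lt.2 ?_⟩⟩
    · have : m / T * p.1 < m / T * T := by
        gcongr; exact ht.2
      rw [div_mul_cancel₀ _ hT.ne'] at this
      exact_mod_cast this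
    · push_cast
      have := mul_le_mul_of_nonneg_left (hx l).1 hmp.le
      linarith
    · push_cast
      exact mul_lt_mul_of_pos_left (hx l).2 hmp
  · intro n
    have hsp := cell_split ν ρ κ₁ κ₂
      (measurableSet_eq_fun (mκ₁.comp measurable_fst) (mκ₁.comp measurable_snd))
      (measurableSet_eq_fun (mκ₂.comp measurable_fst) (mκ₂.comp measurable_snd))
      (v n) (hvm n) (ENNReal.ofReal (T / m)) (ENNReal.ofReal ((1 / (m:ℝ)) ^ N))
      (fun t => by
        rw [← hvol₁ (κ₁ t)]
        refine (Measure.restrict_le_self _).trans (measure_mono fun s hs => ?_)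
        exact (Eq.symm hs))
      (fun y => by
        rw [← hvol₂ (κ₂ y)]
        exact (Measure.restrict_le_self _).trans (measure_mono fun s hs => hs))
    have hset : ∀ p : ℝ × Euc N, (fun p : ℝ × Euc N => (κ₁ p.1, κ₂ p.2)) ⁻¹' {(κ₁ p.1, κ₂ p.2)} =
        {q | κ₁ p.1 = κ₁ q.1 ∧ κ₂ p.2 = κ₂ q.2} := by
      intro p; ext q
      simp [eq_comm]
    simp_rw [hset]
    refine hsp.trans ?_
    have hMr : M = ENNReal.ofReal M.toReal := (ENNReal.ofReal_toReal hMt.ne).symm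
    have t1 : ∫⁻ t, ∫⁻ x, ∫⁻ y, {z : Euc N × Euc N | κ₂ z.1 = κ₂ z.2}.indicator
            (fun z => ‖v n (t, z.1) - v n (t, z.2)‖ₑ) (x, y) ∂ρ ∂ρ ∂ν
        ≤ ENNReal.ofReal ((√N / m) ^ ((N : ℝ) + α)) * M := by
      refine (lintegral_mono fun t => space_cell hα.1 (fun x => v n (t, x))
        ((hvm n).comp (by fun_prop : Measurable fun x => (t, x))) ρ Measure.restrict_le_self m hmp).trans ?_
      rw [lintegral_const_mul' _ _ ENNReal.ofReal_ne_top]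
      gcongr
      exact hvG n
    have t2 := time_cell (v n) (hvm n) M (hvT n) ρ Measure.restrict_le_self (m / T) hmT
    rw [hmTi, show 2 / (m / T) = 2 * (T / m) by field_simp] at t2
    have hM0 : 0 ≤ M.toReal := ENNReal.toReal_nonneg
    calc _ ≤ ENNReal.ofReal (T / m) * (ENNReal.ofReal ((√N / m) ^ ((N : ℝ) + α)) * M) +
          ENNReal.ofReal ((1 / (m:ℝ)) ^ N) * (ENNReal.ofReal (2 * (T / m)) * (ENNReal.ofReal (T / m) * M)) := by
          gcongr
      _ = ENNReal.ofReal ((T / m) * ((√N / m) ^ ((N : ℝ) + α) * M.toReal) +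
      (1 / (m:ℝ)) ^ N * (2 * (T / m) * (T / m * M.toReal))) := by
          have hT' : 0 ≤ T / m := by positivity
          have hp1 : 0 ≤ (√N / m) ^ ((N : ℝ) + α) := by positivity
          have hp2 : 0 ≤ (1 / (m:ℝ)) ^ N := by positivity
          rw [ENNReal.ofReal_add (by positivity) (by positivity), ENNReal.ofReal_mul hT',
            ENNReal.ofReal_mul hp1, ENNReal.ofReal_mul hp2,
            ENNReal.ofReal_mul (q := T / m * M.toReal) (by positivity : 0 ≤ 2 * (T / m)),
            ENNReal.ofReal_mul (q := M.toReal) hT', ← hMr]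
      _ ≤ ENNReal.ofReal (T / m * (1 / (m:ℝ)) ^ N * ε) := ENNReal.ofReal_le_ofReal hmε
      _ = _ := ENNReal.ofReal_mul (by positivity)
end
end
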